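/- Let 𝒜 ⊂ ℕ be finite and suppose s = dim B(𝒜) > 1/2, where dim denotes Hausdorff dimension. Then the s-dimensional Hausdorff measure 𝓗^s restricted to B(𝒜) (normalized to a probability measure) is a Rajchman measure with polynomially decaying Fourier transform: there exists η > 0 such that its Fourier transform at ξ is O(|ξ|^{−η}) as |ξ| → ∞. In particular, this holds for the Hausdorff measure on B_N = B({1,…,N}) for every N ≥ 2. -/

import Mathlib

open MeasureTheory Filter Set Topology
open scoped ENNReal NNReal Classical Real

noncomputable section

/-- The Gauss map `T(x) = 1/x mod 1`. -/
def gaussMap (x : ℝ) : ℝ := Int.fract x⁻¹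

/-- The space `X = [0,1] ∖ ℚ` of irrational numbers in the unit interval. -/
def gaussSet : Set ℝ := {x | x ∈ Set.Icc (0:ℝ) 1 ∧ Irrational x}

/-- The first continued fraction digit `a₁(x) = ⌊1/x⌋`. -/
def cfDigit1 (x : ℝ) : ℕ := ⌊x⁻¹⌋₊

/-- The `(i+1)`-th continued fraction digit `a_{i+1}(x) = a₁(Tⁱ x)`. -/
def cfDigit (i : ℕ) (x : ℝ) : ℕ := cfDigit1 (gaussMap^[i] x)

/-- The inverse branch `T_a(x) = 1/(x+a)` of the Gauss map. -/
def invBranch1 (a : ℕ) (x : ℝ) : ℝ := (x + (a : ℝ))⁻¹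

/-- The composed inverse branch `T_𝐚 = T_{a₁} ∘ ⋯ ∘ T_{aₙ}` for `𝐚 = [a₁,…,aₙ]`. -/
def invBranch (l : List ℕ) (x : ℝ) : ℝ := l.foldr invBranch1 x

/-- The cylinder set `I_𝐚` of points of `X` whose first digits are given by `𝐚`. -/
def cylinder (l : List ℕ) : Set ℝ :=
  {x | x ∈ gaussSet ∧ ∀ i : Fin l.length, cfDigit i.1 x = l.get i}

/-- The Birkhoff sum `S_n φ = ∑_{k<n} φ ∘ T^k`. -/
def birkhoff (φ : ℝ → ℝ) (n : ℕ) (x : ℝ) : ℝ :=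
  ∑ k ∈ Finset.range n, φ (gaussMap^[k] x)

/-- The pair `(pₙ(𝐚), qₙ(𝐚))` of numerator and denominator (continuant) of the
finite continued fraction `[a₁,…,aₙ] = pₙ/qₙ`. -/
def contPQ : List ℕ → ℕ × ℕ
  | [] => (0, 1)
  | a :: l => ((contPQ l).2, a * (contPQ l).2 + (contPQ l).1)

/-- The continuant `qₙ(𝐚)`, the denominator of `[a₁,…,aₙ]` in lowest terms. -/
def contQ (l : List ℕ) : ℕ := (contPQ l).2

/-- Words of length `n` with digits in `ℕ = {1,2,…}`. -/
def Word (n : ℕ) : Type := {l : List ℕ // l.length = n ∧ ∀ a ∈ l, 0 < a}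

/-- The periodic point `𝐚^∞` with periodic continued fraction expansion repeating `𝐚`. -/
def periodicPoint (l : List ℕ) : ℝ :=
  limUnder atTop fun k : ℕ => invBranch (List.flatten (List.replicate k l)) (1/2 : ℝ)

/-- The `n`-th partition sum `∑_{𝐚 ∈ ℕⁿ} exp(S_nφ(𝐚^∞))` appearing in the pressure. -/
def partSum (φ : ℝ → ℝ) (n : ℕ) : ℝ≥0∞ :=
  ∑' l : Word n, ENNReal.ofReal (Real.exp (birkhoff φ n (periodicPoint l.1)))

/-- `φ` has (finite) pressure `P(φ) = p`, i.e. `(1/n) log ∑_{𝐚∈ℕⁿ} exp(S_nφ(𝐚^∞)) → p`. -/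
def HasPressure (φ : ℝ → ℝ) (p : ℝ) : Prop :=
  (∀ n : ℕ, 0 < n → partSum φ n ≠ ⊤) ∧
    Tendsto (fun n : ℕ => Real.log (partSum φ n).toReal / (n : ℝ)) atTop (𝓝 p)

/-- The pressure of `φ` is finite: `P(φ) < ∞`. -/
def PressureFinite (φ : ℝ → ℝ) : Prop := ∃ p : ℝ, HasPressure φ p

/-- `φ` is locally Hölder: oscillation on `n`-cylinders decays geometrically. -/
def LocHolder (φ : ℝ → ℝ) : Prop :=
  ∃ C > (0:ℝ), ∃ θ ∈ Set.Ioo (0:ℝ) 1, ∀ l : List ℕ, l ≠ [] → (∀ a ∈ l, 0 < a) →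
    ∀ x ∈ cylinder l, ∀ y ∈ cylinder l, |φ x - φ y| ≤ C * θ ^ l.length

/-- The normalization `𝓛_φ 1 = 1` of the Ruelle transfer operator of `φ`. -/
def TransferNormalized (φ : ℝ → ℝ) : Prop :=
  ∀ x ∈ gaussSet, ∑' a : ℕ+, Real.exp (φ (invBranch1 (a : ℕ) x)) = 1

/-- `μ` is invariant under the Gauss map. -/
def GaussInvariant (μ : Measure ℝ) : Prop :=
  ∀ s : Set ℝ, MeasurableSet s → μ (gaussMap ⁻¹' s) = μ s

/-- The Gibbs property for the potential `φ` (with `P(φ) = 0`):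
`C⁻¹ e^{S_nφ(T_𝐚 x)} ≤ μ(I_𝐚) ≤ C e^{S_nφ(T_𝐚 x)}`. -/
def IsGibbs (φ : ℝ → ℝ) (μ : Measure ℝ) : Prop :=
  ∃ C : ℝ, 1 ≤ C ∧ ∀ l : List ℕ, l ≠ [] → (∀ a ∈ l, 0 < a) → ∀ x ∈ gaussSet,
    C⁻¹ * Real.exp (birkhoff φ l.length (invBranch l x)) ≤ (μ (cylinder l)).toReal ∧
      (μ (cylinder l)).toReal ≤ C * Real.exp (birkhoff φ l.length (invBranch l x))

/-- The Kolmogorov–Sinai entropy of `μ`: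
`h = lim (1/n) ∑_{𝐚∈ℕⁿ} -μ(I_𝐚) log μ(I_𝐚)`. -/
def HasEntropy (μ : Measure ℝ) (h : ℝ) : Prop :=
  Tendsto (fun n : ℕ => (∑' l : Word n, Real.negMulLog (μ (cylinder l.1)).toReal) / (n : ℝ))
    atTop (𝓝 h)

/-- `log |T'| (x) = log (1/x²)` for the Gauss map. -/
def logAbsDerivGauss (x : ℝ) : ℝ := Real.log (1 / x ^ 2)

/-- The observable `ψ = -log |T'|`. -/
def gaussPsi (x : ℝ) : ℝ := -Real.log (1 / x ^ 2)

/-- The Lyapunov exponent `λ_μ = ∫ log|T'| dμ`. -/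
def lyapunov (μ : Measure ℝ) : ℝ := ∫ x, logAbsDerivGauss x ∂μ

/-- The polynomial tail condition `μ({x : a₁(x) ≥ n}) = O(n^{-δ})`. -/
def PolyTail (μ : Measure ℝ) : Prop :=
  ∃ δ > (0:ℝ), ∃ K : ℝ, ∀ n : ℕ, 0 < n →
    (μ {x | x ∈ gaussSet ∧ n ≤ cfDigit1 x}).toReal ≤ K * (n : ℝ) ^ (-δ)

/-- The Fourier transform `μ̂(ξ) = ∫ e^{-2πiξx} dμ(x)`. -/
def muFourier (μ : Measure ℝ) (ξ : ℝ) : ℂ :=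
  ∫ x, Complex.exp (-(2 * Real.pi * ξ * x : ℝ) * Complex.I) ∂μ

/-- A sequence `u` equidistributes modulo 1. -/
def EquidistributedMod1 (u : ℕ → ℝ) : Prop :=
  ∀ a b : ℝ, 0 ≤ a → a ≤ b → b ≤ 1 →
    Tendsto (fun N : ℕ =>
        (((Finset.range N).filter fun k => Int.fract (u k) ∈ Set.Ico a b).card : ℝ) / (N : ℝ))
      atTop (𝓝 (b - a))

/-- The set `B(𝒜)` of `𝒜`-badly approximable numbers: all digits lie in `𝒜`. -/
def badSet (A : Finset ℕ) : Set ℝ := {x | x ∈ gaussSet ∧ ∀ i : ℕ, cfDigit i x ∈ A}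

/-- Locally Hölder on the subsystem `B(𝒜)`. -/
def LocHolderOn (A : Finset ℕ) (φ : ℝ → ℝ) : Prop :=
  ∃ C > (0:ℝ), ∃ θ ∈ Set.Ioo (0:ℝ) 1, ∀ l : List ℕ, l ≠ [] → (∀ a ∈ l, a ∈ A) →
    ∀ x ∈ cylinder l ∩ badSet A, ∀ y ∈ cylinder l ∩ badSet A,
      |φ x - φ y| ≤ C * θ ^ l.length

/-- The Gibbs property for the Gauss map restricted to `B(𝒜)`. -/
def IsGibbsOn (A : Finset ℕ) (φ : ℝ → ℝ) (μ : Measure ℝ) : Prop :=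
  ∃ C : ℝ, 1 ≤ C ∧ ∀ l : List ℕ, l ≠ [] → (∀ a ∈ l, a ∈ A) → ∀ x ∈ badSet A,
    C⁻¹ * Real.exp (birkhoff φ l.length (invBranch l x)) ≤ (μ (cylinder l)).toReal ∧
      (μ (cylinder l)).toReal ≤ C * Real.exp (birkhoff φ l.length (invBranch l x))

/-- The `n`-regular set `A_n(ε)` of the large deviation decomposition. -/
def regSet (φ : ℝ → ℝ) (lam s ε : ℝ) (n : ℕ) : Set ℝ :=
  {x | |birkhoff gaussPsi n x / (n : ℝ) + lam| < ε ∧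
       |birkhoff φ n x / birkhoff gaussPsi n x - s| < ε}

/-- The collection `𝓡ₙ` of `n`-regular words. -/
def regWords (φ : ℝ → ℝ) (lam s ε : ℝ) (n : ℕ) : Set (List ℕ) :=
  {l | l.length = n ∧ (∀ a ∈ l, 0 < a) ∧
       ∀ k : ℕ, n / 2 ≤ k → k ≤ n → cylinder (l.take k) ⊆ regSet φ lam s ε k}

/-- The union `Rₙ` of the `n`-regular cylinders. -/
def regUnion (φ : ℝ → ℝ) (lam s ε : ℝ) (n : ℕ) : Set ℝ :=
  ⋃ l ∈ regWords φ lam s ε n, cylinder l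

end

namespace ReversedWord

/-- The continuants `(qₙ, qₙ₋₁)` of a word, where the word is listed from its last digit to its
first one. -/
noncomputable def denPair : List ℕ → ℝ × ℝ
  | [] => (1, 0)
  | a :: l => (a * (denPair l).1 + (denPair l).2, (denPair l).1)

/-- The continuant `qₙ` of a reversed word. -/
noncomputable def den (l : List ℕ) : ℝ := (denPair l).1

/-- The continuant `qₙ₋₁` of a reversed word. -/
noncomputable def prevDen (l : List ℕ) : ℝ := (denPair l).2

/-- The affine function `qₙ + x qₙ₋₁`; the branch of the word has derivative `± (qₙ + x qₙ₋₁)⁻²`. -/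
noncomputable def jac (l : List ℕ) (x : ℝ) : ℝ := den l + x * prevDen l

/-- The inverse branch `T_{aₙ ⋯ a₁}` of a word, listed from its last digit to its first one. -/
noncomputable def branch : List ℕ → ℝ → ℝ
  | [], x => x
  | a :: l, x => branch l (invBranch1 a x)

/-- The size `qₙ + qₙ₋₁` of a word. -/
noncomputable def size (l : List ℕ) : ℝ := jac l 1

/-- The size of the parent of a word in the tree of words (`0` for the root). -/
noncomputable def parentSize : List ℕ → ℝ
  | [] => 0
  | _ :: l => size l

@[simp] lemma den_nil : den [] = 1 := rfl
@[simp] lemma prevDen_nil : prevDen [] = 0 := rfl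
@[simp] lemma den_cons (a : ℕ) (l : List ℕ) : den (a :: l) = a * den l + prevDen l := rfl
@[simp] lemma prevDen_cons (a : ℕ) (l : List ℕ) : prevDen (a :: l) = den l := rfl
@[simp] lemma branch_nil (x : ℝ) : branch [] x = x := rfl
@[simp] lemma branch_cons (a : ℕ) (l : List ℕ) (x : ℝ) :
    branch (a :: l) x = branch l (invBranch1 a x) := rfl
@[simp] lemma parentSize_nil : parentSize [] = 0 := rfl
@[simp] lemma parentSize_cons (a : ℕ) (l : List ℕ) : parentSize (a :: l) = size l := rfl
lemma size_eq (l : List ℕ) : size l = den l + prevDen l := by simp [size, jac]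
lemma size_nil : size [] = 1 := by simp [size_eq]

lemma den_bounds {l : List ℕ} (hl : ∀ a ∈ l, 1 ≤ a) :
    1 ≤ den l ∧ 0 ≤ prevDen l ∧ prevDen l ≤ den l := by
  induction l with
  | nil => simp
  | cons a l ih =>
    obtain ⟨h1, h2, h3⟩ := ih fun b hb => hl b (List.mem_cons_of_mem _ hb)
    have ha : (1 : ℝ) ≤ a := by exact_mod_cast hl a List.mem_cons_self
    simp only [den_cons, prevDen_cons]
    refine ⟨by nlinarith, by linarith, by nlinarith⟩

lemma invBranch1_mem {a : ℕ} (ha : 1 ≤ a) {x : ℝ} (hx : 0 ≤ x) :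
    0 ≤ invBranch1 a x ∧ invBranch1 a x ≤ 1 := by
  have ha : (1 : ℝ) ≤ a := by exact_mod_cast ha
  exact ⟨by unfold invBranch1; positivity, inv_le_one_of_one_le₀ (by linarith)⟩

lemma abs_invBranch1_sub {a b : ℕ} (ha : 1 ≤ a) (hb : 1 ≤ b) {x y : ℝ} (hx : 0 ≤ x) (hy : 0 ≤ y) :
    |invBranch1 a x - invBranch1 b y| = |x + a - (y + b)| / ((x + a) * (y + b)) := by
  have ha : (1 : ℝ) ≤ a := by exact_mod_cast ha
  have hb : (1 : ℝ) ≤ b := by exact_mod_cast hb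
  have h1 : 0 < x + a := by linarith
  have h2 : 0 < y + b := by linarith
  have : invBranch1 a x - invBranch1 b y = -(x + a - (y + b)) / ((x + a) * (y + b)) := by
    unfold invBranch1; field_simp; ring
  rw [this, abs_div, abs_neg, abs_of_pos (mul_pos h1 h2)]

lemma jac_pos {l : List ℕ} (hl : ∀ a ∈ l, 1 ≤ a) {x : ℝ} (hx : 0 ≤ x) : 0 < jac l x := by
  obtain ⟨h1, h2, -⟩ := den_bounds hl
  unfold jac; positivity

lemma den_le_jac {l : List ℕ} (hl : ∀ a ∈ l, 1 ≤ a) {x : ℝ} (hx : 0 ≤ x) : den l ≤ jac l x := by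
  obtain ⟨h1, h2, -⟩ := den_bounds hl
  have := mul_nonneg hx h2
  unfold jac; linarith

lemma size_le_two_den {l : List ℕ} (hl : ∀ a ∈ l, 1 ≤ a) : size l ≤ 2 * den l := by
  obtain ⟨h1, h2, h3⟩ := den_bounds hl
  rw [size_eq]; linarith

lemma den_le_size {l : List ℕ} (hl : ∀ a ∈ l, 1 ≤ a) : den l ≤ size l := by
  obtain ⟨h1, h2, h3⟩ := den_bounds hl
  rw [size_eq]; linarith

lemma one_le_size {l : List ℕ} (hl : ∀ a ∈ l, 1 ≤ a) : 1 ≤ size l :=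
  (den_bounds hl).1.trans (den_le_size hl)

lemma jac_le_size {l : List ℕ} (hl : ∀ a ∈ l, 1 ≤ a) {x : ℝ} (hx : x ≤ 1) :
    jac l x ≤ size l := by
  obtain ⟨h1, h2, h3⟩ := den_bounds hl
  rw [size_eq, jac]; nlinarith

lemma jac_cons (a : ℕ) (ha : 1 ≤ a) (l : List ℕ) {x : ℝ} (hx : 0 ≤ x) :
    jac (a :: l) x = (x + a) * jac l (invBranch1 a x) := by
  have ha : (1 : ℝ) ≤ a := by exact_mod_cast ha
  have : x + (a : ℝ) ≠ 0 := by positivity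
  simp only [jac, den_cons, prevDen_cons, invBranch1]
  field_simp
  ring

lemma branch_mem {l : List ℕ} (hl : ∀ a ∈ l, 1 ≤ a) {x : ℝ} (hx : 0 ≤ x) (hx1 : x ≤ 1) :
    0 ≤ branch l x ∧ branch l x ≤ 1 := by
  induction l generalizing x with
  | nil => exact ⟨hx, hx1⟩
  | cons a l ih =>
    obtain ⟨h1, h2⟩ := invBranch1_mem (hl a List.mem_cons_self) hx
    exact ih (fun b hb => hl b (List.mem_cons_of_mem _ hb)) h1 h2

lemma jac_append {c u : List ℕ} (hc : ∀ a ∈ c, 1 ≤ a) {x : ℝ} (hx : 0 ≤ x) :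
    jac (c ++ u) x = jac c x * jac u (branch c x) := by
  induction c generalizing x with
  | nil => simp [jac]
  | cons a c ih =>
    have ha := hc a List.mem_cons_self
    rw [List.cons_append, jac_cons a ha _ hx, jac_cons a ha _ hx,
      ih (fun b hb => hc b (List.mem_cons_of_mem _ hb)) (invBranch1_mem ha hx).1, branch_cons]
    ring

lemma size_append_le {c u : List ℕ} (hc : ∀ a ∈ c, 1 ≤ a) (hu : ∀ a ∈ u, 1 ≤ a) :
    size (c ++ u) ≤ size c * size u := by
  have h1 := branch_mem hc zero_le_one le_rfl
  rw [size, jac_append hc zero_le_one]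
  exact mul_le_mul_of_nonneg_left (jac_le_size hu h1.2) (jac_pos hc zero_le_one).le

lemma le_size_append {c u : List ℕ} (hc : ∀ a ∈ c, 1 ≤ a) (hu : ∀ a ∈ u, 1 ≤ a) :
    size c * size u ≤ 2 * size (c ++ u) := by
  have h1 := branch_mem hc zero_le_one le_rfl
  have h2 := den_le_jac hu h1.1
  have h3 := size_le_two_den hu
  have h4 := jac_pos hc zero_le_one
  rw [size, size, size, jac_append hc zero_le_one]
  rw [size] at h3
  nlinarith

lemma size_cons_ge {a : ℕ} (ha : 1 ≤ a) {l : List ℕ} (hl : ∀ a ∈ l, 1 ≤ a) :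
    3 / 2 * size l ≤ size (a :: l) := by
  obtain ⟨h1, h2, h3⟩ := den_bounds hl
  have ha : (1 : ℝ) ≤ a := by exact_mod_cast ha
  rw [size_eq, size_eq, den_cons, prevDen_cons]
  nlinarith

lemma size_cons_le {a N : ℕ} (ha : a ≤ N) {l : List ℕ} (hl : ∀ a ∈ l, 1 ≤ a) :
    size (a :: l) ≤ (N + 1) * size l := by
  obtain ⟨h1, h2, h3⟩ := den_bounds hl
  have ha : (a : ℝ) ≤ N := by exact_mod_cast ha
  have hN : (0 : ℝ) ≤ N := by positivity
  rw [size_eq, size_eq, den_cons, prevDen_cons]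
  nlinarith

lemma pow_length_le_size {l : List ℕ} (hl : ∀ a ∈ l, 1 ≤ a) : (3 / 2 : ℝ) ^ l.length ≤ size l := by
  induction l with
  | nil => simp [size_nil]
  | cons a l ih =>
    have hl' : ∀ a ∈ l, 1 ≤ a := fun b hb => hl b (List.mem_cons_of_mem _ hb)
    have := size_cons_ge (hl a List.mem_cons_self) hl'
    have := ih hl'
    rw [List.length_cons, pow_succ]
    linarith

lemma abs_branch_sub {l : List ℕ} (hl : ∀ a ∈ l, 1 ≤ a) {x y : ℝ} (hx : 0 ≤ x) (hy : 0 ≤ y) :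
    |branch l x - branch l y| = |x - y| / (jac l x * jac l y) := by
  induction l generalizing x y with
  | nil => simp [jac]
  | cons a l ih =>
    have ha := hl a List.mem_cons_self
    have hl' : ∀ a ∈ l, 1 ≤ a := fun b hb => hl b (List.mem_cons_of_mem _ hb)
    have h1 := (invBranch1_mem ha hx).1
    have h2 := (invBranch1_mem ha hy).1
    rw [branch_cons, branch_cons, ih hl' h1 h2, abs_invBranch1_sub ha ha hx hy,
      jac_cons a ha _ hx, jac_cons a ha _ hy]
    have h3 := jac_pos hl' h1
    have h4 := jac_pos hl' h2
    have : 0 < x + a := by have : (1 : ℝ) ≤ a := by exact_mod_cast ha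
                           linarith
    have : 0 < y + a := by have : (1 : ℝ) ≤ a := by exact_mod_cast ha
                           linarith
    rw [add_sub_add_right_eq_sub]
    field_simp

lemma hasDerivAt_invBranch1 {a : ℕ} (ha : 1 ≤ a) {x : ℝ} (hx : 0 ≤ x) :
    HasDerivAt (invBranch1 a) (-1 / (x + a) ^ 2) x := by
  have ha : (1 : ℝ) ≤ a := by exact_mod_cast ha
  exact ((hasDerivAt_id x).add_const (a : ℝ)).inv (by simp; positivity)

lemma hasDerivAt_branch {l : List ℕ} (hl : ∀ a ∈ l, 1 ≤ a) {x : ℝ} (hx : 0 ≤ x) :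
    HasDerivAt (branch l) ((-1) ^ l.length / jac l x ^ 2) x := by
  induction l generalizing x with
  | nil =>
    have h : HasDerivAt (branch []) 1 x := hasDerivAt_id x
    exact h.congr_deriv (by simp [jac])
  | cons a l ih =>
    have ha := hl a List.mem_cons_self
    have hl' : ∀ a ∈ l, 1 ≤ a := fun b hb => hl b (List.mem_cons_of_mem _ hb)
    have h1 := (invBranch1_mem ha hx).1
    have h := (ih hl' h1).comp x (hasDerivAt_invBranch1 ha hx)
    have h3 := jac_pos hl' h1
    have : 0 < x + a := by have : (1 : ℝ) ≤ a := by exact_mod_cast ha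
                           linarith
    refine HasDerivAt.congr_deriv (f' := _) h ?_
    rw [jac_cons a ha _ hx, List.length_cons, pow_succ]
    field_simp
    ring

/-- The determinant of the continuants of two words. -/
noncomputable def cross (r r' : List ℕ) : ℝ := den r * prevDen r' - prevDen r * den r'

lemma abs_cross_append (c u v : List ℕ) : |cross (c ++ u) (c ++ v)| = |cross u v| := by
  induction c with
  | nil => rfl
  | cons a c ih =>
    rw [← ih, ← abs_neg]
    simp only [cross, List.cons_append, den_cons, prevDen_cons]
    congr 1; ring

lemma den_mul_le_cross {N : ℕ} {a b : ℕ} (hab : a ≠ b) {u v : List ℕ}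
    (hu : ∀ a ∈ u, 1 ≤ a ∧ a ≤ N) (hv : ∀ a ∈ v, 1 ≤ a ∧ a ≤ N) (hu0 : u ≠ []) (hv0 : v ≠ []) :
    den u * den v ≤ (N + 1) * |cross (a :: u) (b :: v)| := by
  have key : ∀ w : List ℕ, (∀ a ∈ w, 1 ≤ a ∧ a ≤ N) → w ≠ [] →
      0 < den w ∧ den w ≤ (N + 1) * prevDen w ∧ prevDen w ≤ den w := by
    intro w hw hw0
    obtain ⟨h1, h2, h3⟩ := den_bounds fun a ha => (hw a ha).1
    refine ⟨by linarith, ?_, h3⟩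
    match w, hw0 with
    | a :: l, _ =>
      have ha : (a : ℝ) ≤ N := by exact_mod_cast (hw a List.mem_cons_self).2
      obtain ⟨h4, h5, h6⟩ := den_bounds (l := l)
        fun a ha => (hw a (List.mem_cons_of_mem _ ha)).1
      simp only [den_cons, prevDen_cons]
      nlinarith
  obtain ⟨u1, u2, u3⟩ := key u hu hu0
  obtain ⟨v1, v2, v3⟩ := key v hv hv0
  have hN : (0 : ℝ) ≤ N := by positivity
  have hc : cross (a :: u) (b :: v) =
      ((a : ℝ) - b) * (den u * den v) + (prevDen u * den v - den u * prevDen v) := by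
    simp only [cross, den_cons, prevDen_cons]; ring
  have hd : 0 < den u * den v := mul_pos u1 v1
  have e1 : den u * den v ≤ (N + 1) * (prevDen u * den v) := by nlinarith
  have e2 : den u * den v ≤ (N + 1) * (den u * prevDen v) := by nlinarith
  have e3 : prevDen u * den v ≤ den u * den v := by nlinarith
  have e4 : den u * prevDen v ≤ den u * den v := by nlinarith
  rcases lt_or_gt_of_ne hab with h | h
  · have h : (a : ℝ) + 1 ≤ b := by exact_mod_cast h
    have : den u * den v + den u * prevDen v - prevDen u * den v ≤ |cross (a :: u) (b :: v)| := by
      refine le_trans ?_ (neg_le_abs _)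
      rw [hc]; nlinarith
    nlinarith
  · have h : (b : ℝ) + 1 ≤ a := by exact_mod_cast h
    have : den u * den v + prevDen u * den v - den u * prevDen v ≤ |cross (a :: u) (b :: v)| := by
      refine le_trans ?_ (le_abs_self _)
      rw [hc]; nlinarith
    nlinarith

lemma exists_common_prefix (r r' : List ℕ) : ∃ c u v, r = c ++ u ∧ r' = c ++ v ∧
    (u.length ≤ 1 ∨ v.length ≤ 1 ∨ ∃ a b u' v', a ≠ b ∧ u' ≠ [] ∧ v' ≠ [] ∧ u = a :: u' ∧
      v = b :: v') := by
  induction r generalizing r' with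
  | nil => exact ⟨[], [], r', rfl, rfl, by simp⟩
  | cons a r ih =>
    cases r' with
    | nil => exact ⟨[], a :: r, [], rfl, rfl, by simp⟩
    | cons b r' =>
      by_cases hab : a = b
      · subst hab
        obtain ⟨c, u, v, rfl, rfl, h⟩ := ih r'
        exact ⟨a :: c, u, v, rfl, rfl, h⟩
      · refine ⟨[], a :: r, b :: r', rfl, rfl, ?_⟩
        by_cases hr : r = []
        · simp [hr]
        by_cases hr' : r' = []
        · simp [hr']
        exact .inr (.inr ⟨a, b, r, r', hab, hr, hr', rfl, rfl⟩)

end ReversedWord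

section Oscillation

lemma mul_integral_inv_affine_sq_add_sq_le (α β : ℝ) {κ : ℝ} (hκ : 0 < κ) :
    |β| * ∫ x in (0 : ℝ)..2, 1 / ((α + β * x) ^ 2 + κ ^ 2) ≤ π / κ := by
  have hpos : ∀ x, 0 < (α + β * x) ^ 2 + κ ^ 2 := fun x => by positivity
  have hd : ∀ x ∈ uIcc (0 : ℝ) 2, HasDerivAt (fun x => Real.arctan ((α + β * x) / κ) / κ)
      (β * (1 / ((α + β * x) ^ 2 + κ ^ 2))) x := by
    intro x _
    have h1 : HasDerivAt (fun x => (α + β * x) / κ) (β / κ) x := by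
      simpa using (((hasDerivAt_id x).const_mul β).const_add α).div_const κ
    refine (h1.arctan.div_const κ).congr_deriv ?_
    have := hpos x
    have : 1 + ((α + β * x) / κ) ^ 2 ≠ 0 := by positivity
    field_simp
    ring
  have hc : Continuous fun x => 1 / ((α + β * x) ^ 2 + κ ^ 2) :=
    continuous_const.div (by fun_prop) fun x => (hpos x).ne'
  have hi := intervalIntegral.integral_eq_sub_of_hasDerivAt hd
    ((continuous_const.mul hc).intervalIntegrable _ _)
  rw [intervalIntegral.integral_const_mul] at hi
  have h0 : 0 ≤ ∫ x in (0 : ℝ)..2, 1 / ((α + β * x) ^ 2 + κ ^ 2) :=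
    intervalIntegral.integral_nonneg (by norm_num) fun x _ => (by have := hpos x; positivity)
  rw [← abs_of_nonneg h0, ← abs_mul, hi, ← sub_div, abs_div, abs_of_pos hκ]
  gcongr
  rw [abs_le]
  have a1 := Real.arctan_lt_pi_div_two ((α + β * 2) / κ)
  have a2 := Real.neg_pi_div_two_lt_arctan ((α + β * 2) / κ)
  have a3 := Real.arctan_lt_pi_div_two ((α + β * 0) / κ)
  have a4 := Real.neg_pi_div_two_lt_arctan ((α + β * 0) / κ)
  constructor <;> linarith

lemma add_mul_integral_inv_affine_sq_add_sq_le (α β : ℝ) {κ : ℝ} (hκ : 0 < κ) :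
    (|α| + |β|) * ∫ x in (0 : ℝ)..2, 1 / ((α + β * x) ^ 2 + κ ^ 2) ≤ 5 * π / κ := by
  have hpos : ∀ x, 0 < (α + β * x) ^ 2 + κ ^ 2 := fun x => by positivity
  have hc : Continuous fun x => 1 / ((α + β * x) ^ 2 + κ ^ 2) :=
    continuous_const.div (by fun_prop) fun x => (hpos x).ne'
  have h0 : 0 ≤ ∫ x in (0 : ℝ)..2, 1 / ((α + β * x) ^ 2 + κ ^ 2) :=
    intervalIntegral.integral_nonneg (by norm_num) fun x _ => (by have := hpos x; positivity)
  have h1 := mul_integral_inv_affine_sq_add_sq_le α β hκ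
  set J := ∫ x in (0 : ℝ)..2, 1 / ((α + β * x) ^ 2 + κ ^ 2)
  by_cases h : |α| ≤ 4 * |β|
  · calc (|α| + |β|) * J ≤ 5 * (|β| * J) := by nlinarith
      _ ≤ 5 * (π / κ) := by linarith
      _ = _ := by ring
  · push Not at h
    have hα : 0 < |α| := lt_of_le_of_lt (by positivity) h
    have hJ : J ≤ ∫ x in (0 : ℝ)..2, 1 / (|α| * κ) := by
      refine intervalIntegral.integral_mono_on (by norm_num) (hc.intervalIntegrable _ _)
        (continuous_const.intervalIntegrable _ _) fun x hx => ?_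
      apply one_div_le_one_div_of_le (by positivity)
      have hL : |α| / 2 ≤ |α + β * x| := by
        have := abs_sub_abs_le_abs_sub α (-(β * x))
        rw [abs_neg, abs_mul, abs_of_nonneg hx.1, sub_neg_eq_add] at this
        nlinarith [hx.2, abs_nonneg β]
      rw [← sq_abs (α + β * x)]
      nlinarith [sq_nonneg (|α + β * x| - κ)]
    rw [intervalIntegral.integral_const, smul_eq_mul] at hJ
    have e1 : |α| * J ≤ 2 / κ := by
      calc |α| * J ≤ |α| * ((2 - 0) * (1 / (|α| * κ))) := mul_le_mul_of_nonneg_left hJ (abs_nonneg _)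
        _ = _ := by field_simp; norm_num
    have e2 : |β| * J ≤ π / κ := h1
    have : 2 / κ + π / κ ≤ 5 * π / κ := by
      rw [← add_div]; gcongr; linarith [Real.pi_gt_three]
    nlinarith

variable {p₁ m₁ p₂ m₂ σ s Q C κ : ℝ} {g : ℝ → ℝ}

set_option maxHeartbeats 2000000 in
lemma norm_integral_amplitude_le (hs : 0 < s) (hs1 : s ≤ 1) (hQ : 0 < Q) (hC : 1 ≤ C)
    (hκ : 0 < κ) (hσ : σ ≠ 0)
    (hp₁ : Q / 2 ≤ p₁ ∧ p₁ ≤ C * Q) (hp₂ : Q / 2 ≤ p₂ ∧ p₂ ≤ C * Q)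
    (hm₁ : 0 ≤ m₁ ∧ m₁ ≤ p₁) (hm₂ : 0 ≤ m₂ ∧ m₂ ≤ p₂)
    (hX : p₁ * m₂ - m₁ * p₂ ≠ 0)
    (hg : ∀ x ∈ Icc (0 : ℝ) 2,
      HasDerivAt g (σ * (1 / (p₁ + x * m₁) ^ 2 - 1 / (p₂ + x * m₂) ^ 2)) x) :
    ‖∫ x in (0 : ℝ)..2, (((p₁ + x * m₁) * (p₂ + x * m₂)) ^ (-2 * s) : ℝ) *
      Complex.exp (g x * Complex.I)‖ ≤
      ((Q / 2) * (Q / 2)) ^ (-2 * s) * (270 * C ^ 3 * Q ^ 3 / (|σ| * κ) +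
        κ * (5 * π) * (C * Q) / |p₁ * m₂ - m₁ * p₂|) := by
  set d₁ : ℝ → ℝ := fun x => p₁ + x * m₁ with hd₁
  set d₂ : ℝ → ℝ := fun x => p₂ + x * m₂ with hd₂
  set α := p₂ - p₁ with hα
  set β := m₂ - m₁ with hβ
  set a₀ := ((Q / 2) * (Q / 2)) ^ (-2 * s) with ha₀
  have ha₀' : 0 < a₀ := by positivity
  have hL : ∀ x, α + β * x = d₂ x - d₁ x := fun x => by simp only [hα, hβ, hd₁, hd₂]; ring
  have hb₁ : ∀ x ∈ Icc (0 : ℝ) 2, Q / 2 ≤ d₁ x ∧ d₁ x ≤ 3 * C * Q ∧ m₁ ≤ d₁ x := by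
    intro x hx
    have := mul_nonneg hx.1 hm₁.1
    have : x * m₁ ≤ 2 * m₁ := mul_le_mul_of_nonneg_right hx.2 hm₁.1
    exact ⟨by linarith [hp₁.1], by linarith [hp₁.2, hm₁.2], by linarith [hm₁.2]⟩
  have hb₂ : ∀ x ∈ Icc (0 : ℝ) 2, Q / 2 ≤ d₂ x ∧ d₂ x ≤ 3 * C * Q ∧ m₂ ≤ d₂ x := by
    intro x hx
    have := mul_nonneg hx.1 hm₂.1
    have : x * m₂ ≤ 2 * m₂ := mul_le_mul_of_nonneg_right hx.2 hm₂.1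
    exact ⟨by linarith [hp₂.1], by linarith [hp₂.2, hm₂.2], by linarith [hm₂.2]⟩
  have hpos₁ : ∀ x ∈ Icc (0 : ℝ) 2, 0 < d₁ x := fun x hx => by linarith [(hb₁ x hx).1]
  have hpos₂ : ∀ x ∈ Icc (0 : ℝ) 2, 0 < d₂ x := fun x hx => by linarith [(hb₂ x hx).1]
  set amp : ℝ → ℝ := fun x => (d₁ x * d₂ x) ^ (-2 * s) with hamp
  set P : ℝ → ℝ := fun x => (d₁ x * d₂ x) ^ (2 - 2 * s) / (d₁ x + d₂ x) with hP
  set P' : ℝ → ℝ := fun x => P x * ((2 - 2 * s) * (m₁ / d₁ x + m₂ / d₂ x) -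
    (m₁ + m₂) / (d₁ x + d₂ x)) with hP'
  set u : ℝ → ℝ := fun x => (α + β * x) / ((α + β * x) ^ 2 + κ ^ 2) with hu
  set u' : ℝ → ℝ := fun x => β * (κ ^ 2 - (α + β * x) ^ 2) / ((α + β * x) ^ 2 + κ ^ 2) ^ 2
    with hu'
  set K : ℝ → ℝ := fun x => 1 / ((α + β * x) ^ 2 + κ ^ 2) with hK
  have hKpos : ∀ x, 0 < (α + β * x) ^ 2 + κ ^ 2 := fun x => by positivity
  have hder₁ : ∀ x, HasDerivAt d₁ m₁ x := fun x => by
    simpa [hd₁] using ((hasDerivAt_id x).mul_const m₁).const_add p₁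
  have hder₂ : ∀ x, HasDerivAt d₂ m₂ x := fun x => by
    simpa [hd₂] using ((hasDerivAt_id x).mul_const m₂).const_add p₂
  have hPder : ∀ x ∈ Icc (0 : ℝ) 2, HasDerivAt P (P' x) x := by
    intro x hx
    have h1 := hpos₁ x hx
    have h2 := hpos₂ x hx
    refine ((((hder₁ x).mul (hder₂ x)).rpow_const (p := 2 - 2 * s)
      (.inl (mul_pos h1 h2).ne')).div ((hder₁ x).add (hder₂ x)) (add_pos h1 h2).ne').congr_deriv ?_
    simp only [hP', hP, Pi.mul_apply, Pi.add_apply]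
    rw [Real.rpow_sub_one (mul_pos h1 h2).ne']
    field_simp
  have huder : ∀ x, HasDerivAt u (u' x) x := by
    intro x
    have h1 : HasDerivAt (fun x => α + β * x) β x := by
      simpa using ((hasDerivAt_id x).const_mul β).const_add α
    refine (h1.div ((h1.pow 2).add_const (κ ^ 2)) (hKpos x).ne').congr_deriv ?_
    simp only [hu']
    congr 1
    simp only [Nat.cast_ofNat, Pi.pow_apply]
    ring
  have hamp_le : ∀ x ∈ Icc (0 : ℝ) 2, 0 ≤ amp x ∧ amp x ≤ a₀ := by
    intro x hx
    have h1 := hpos₁ x hx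
    have h2 := hpos₂ x hx
    refine ⟨by positivity, Real.rpow_le_rpow_of_nonpos (by positivity) ?_ (by linarith)⟩
    exact mul_le_mul (hb₁ x hx).1 (hb₂ x hx).1 (by positivity) h1.le
  have hPamp : ∀ x ∈ Icc (0 : ℝ) 2, P x = amp x * ((d₁ x * d₂ x) ^ 2 / (d₁ x + d₂ x)) := by
    intro x hx
    have h1 := hpos₁ x hx
    have h2 := hpos₂ x hx
    simp only [hP, hamp]
    rw [show 2 - 2 * s = -2 * s + (2 : ℕ) by push_cast; ring, Real.rpow_add_natCast (by positivity)]
    ring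
  set P₀ := a₀ * (27 * C ^ 3 * Q ^ 3) with hP₀
  have hP_le : ∀ x ∈ Icc (0 : ℝ) 2, 0 ≤ P x ∧ P x ≤ P₀ := by
    intro x hx
    have h1 := hpos₁ x hx
    have h2 := hpos₂ x hx
    refine ⟨by positivity, ?_⟩
    rw [hPamp x hx]
    refine mul_le_mul (hamp_le x hx).2 ?_ (by positivity) ha₀'.le
    calc (d₁ x * d₂ x) ^ 2 / (d₁ x + d₂ x) ≤ d₁ x ^ 2 * d₂ x := by
          rw [div_le_iff₀ (by positivity)]
          have : 0 ≤ d₁ x ^ 3 * d₂ x := by positivity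
          nlinarith
      _ ≤ (3 * C * Q) ^ 2 * (3 * C * Q) := by
          have := (hb₁ x hx).2.1
          have := (hb₂ x hx).2.1
          gcongr
      _ = _ := by ring
  have hP'_le : ∀ x ∈ Icc (0 : ℝ) 2, |P' x| ≤ 5 * P₀ := by
    intro x hx
    have h1 := hpos₁ x hx
    have h2 := hpos₂ x hx
    obtain ⟨hPx, hPx'⟩ := hP_le x hx
    have e1 : m₁ / d₁ x ≤ 1 := (div_le_one h1).2 (hb₁ x hx).2.2
    have e2 : m₂ / d₂ x ≤ 1 := (div_le_one h2).2 (hb₂ x hx).2.2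
    have e3 : (m₁ + m₂) / (d₁ x + d₂ x) ≤ 1 :=
      (div_le_one (by linarith)).2 (add_le_add (hb₁ x hx).2.2 (hb₂ x hx).2.2)
    have e4 : 0 ≤ m₁ / d₁ x := div_nonneg hm₁.1 h1.le
    have e5 : 0 ≤ m₂ / d₂ x := div_nonneg hm₂.1 h2.le
    have e6 : 0 ≤ (m₁ + m₂) / (d₁ x + d₂ x) := div_nonneg (add_nonneg hm₁.1 hm₂.1) (by linarith)
    simp only [hP']
    rw [abs_mul, abs_of_nonneg hPx]
    have : |(2 - 2 * s) * (m₁ / d₁ x + m₂ / d₂ x) - (m₁ + m₂) / (d₁ x + d₂ x)| ≤ 5 := by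
      rw [abs_le]; constructor <;> nlinarith
    nlinarith [abs_nonneg ((2 - 2 * s) * (m₁ / d₁ x + m₂ / d₂ x) - (m₁ + m₂) / (d₁ x + d₂ x))]
  have hu_le : ∀ x, |u x| ≤ 1 / (2 * κ) := by
    intro x
    simp only [hu]
    rw [abs_div, abs_of_pos (hKpos x), div_le_div_iff₀ (hKpos x) (by positivity),
      ← sq_abs (α + β * x)]
    nlinarith [sq_nonneg (|α + β * x| - κ)]
  have hu'_le : ∀ x, |u' x| ≤ |β| * K x := by
    intro x
    simp only [hu', hK]
    have := hKpos x
    rw [abs_div, abs_mul, abs_of_pos (pow_pos (hKpos x) 2), mul_div_assoc]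
    refine mul_le_mul_of_nonneg_left ?_ (abs_nonneg β)
    rw [div_le_div_iff₀ (by positivity) (by positivity)]
    have : |κ ^ 2 - (α + β * x) ^ 2| ≤ (α + β * x) ^ 2 + κ ^ 2 := by
      rw [abs_le]; constructor <;> nlinarith [sq_nonneg κ, sq_nonneg (α + β * x)]
    nlinarith
  have hu_c : Continuous u := by
    simp only [hu]; exact Continuous.div (by fun_prop) (by fun_prop) fun x => (hKpos x).ne'
  have hu'_c : Continuous u' := by
    simp only [hu']
    exact Continuous.div (by fun_prop) (by fun_prop) fun x => (pow_pos (hKpos x) 2).ne'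
  have hK_c : Continuous K := by
    simp only [hK]; exact Continuous.div (by fun_prop) (by fun_prop) fun x => (hKpos x).ne'
  have hd₁c : Continuous d₁ := by fun_prop
  have hd₂c : Continuous d₂ := by fun_prop
  have hI : uIcc (0 : ℝ) 2 = Icc 0 2 := uIcc_of_le (by norm_num)
  have hPc : ContinuousOn P (Icc 0 2) := fun x hx => (hPder x hx).continuousAt.continuousWithinAt
  have hampc : ContinuousOn amp (Icc 0 2) := by
    refine ContinuousOn.rpow_const (by fun_prop) fun x hx => .inl ?_
    exact (mul_pos (hpos₁ x hx) (hpos₂ x hx)).ne'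
  have hP'c : ContinuousOn P' (Icc 0 2) := by
    refine hPc.mul ((continuousOn_const.mul ((continuousOn_const.div hd₁c.continuousOn
      fun x hx => (hpos₁ x hx).ne').add (continuousOn_const.div hd₂c.continuousOn
      fun x hx => (hpos₂ x hx).ne'))).sub (continuousOn_const.div (by fun_prop) fun x hx => ?_))
    exact (add_pos (hpos₁ x hx) (hpos₂ x hx)).ne'
  have hgc : ContinuousOn g (Icc 0 2) := fun x hx => (hg x hx).continuousAt.continuousWithinAt
  set e : ℝ → ℂ := fun x => Complex.exp (g x * Complex.I) with he
  have hec : ContinuousOn e (Icc 0 2) := by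
    simp only [he]; fun_prop
  have hen : ∀ x, ‖e x‖ = 1 := fun x => Complex.norm_exp_ofReal_mul_I _
  -- integration by parts against the regularised multiplier `P * u`
  have hgder : ∀ x ∈ Icc (0 : ℝ) 2, P x * u x * (σ * (1 / (d₁ x) ^ 2 - 1 / (d₂ x) ^ 2)) =
      σ * (amp x - amp x * κ ^ 2 * K x) := by
    intro x hx
    have h1 := hpos₁ x hx
    have h2 := hpos₂ x hx
    have h3 := hKpos x
    rw [hPamp x hx]
    simp only [hu, hK]
    rw [hL] at h3 ⊢
    field_simp
    ring
  have hibp : ∫ x in (0 : ℝ)..2, (((P' x * u x + P x * u' x : ℝ) : ℂ) * e x +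
      ((σ * (amp x - amp x * κ ^ 2 * K x) : ℝ) : ℂ) * Complex.I * e x) =
      ((P 2 * u 2 : ℝ) : ℂ) * e 2 - ((P 0 * u 0 : ℝ) : ℂ) * e 0 := by
    apply intervalIntegral.integral_eq_sub_of_hasDerivAt (f := fun x => ((P x * u x : ℝ) : ℂ) * e x)
    · intro x hx
      rw [hI] at hx
      have h1 := ((hPder x hx).mul (huder x)).ofReal_comp
      have h2 := (((show HasDerivAt g (σ * (1 / (d₁ x) ^ 2 - 1 / (d₂ x) ^ 2)) x from
        hg x hx).ofReal_comp).mul_const Complex.I).cexp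
      refine (h1.mul h2).congr_deriv ?_
      rw [← hgder x hx]
      simp only [he, Pi.mul_apply]
      push_cast
      ring
    · apply ContinuousOn.intervalIntegrable
      rw [hI]
      refine ContinuousOn.add (ContinuousOn.mul ?_ hec) (ContinuousOn.mul (ContinuousOn.mul ?_
        continuousOn_const) hec)
      · exact Complex.continuous_ofReal.comp_continuousOn
          ((hP'c.mul hu_c.continuousOn).add (hPc.mul hu'_c.continuousOn))
      · exact Complex.continuous_ofReal.comp_continuousOn
          (continuousOn_const.mul (hampc.sub ((hampc.mul continuousOn_const).mul hK_c.continuousOn)))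
  have hint : ∀ {f : ℝ → ℝ}, ContinuousOn f (Icc 0 2) →
      IntervalIntegrable (fun x => ((f x : ℝ) : ℂ) * e x) volume 0 2 := fun {f} hf => by
    apply ContinuousOn.intervalIntegrable
    rw [hI]
    exact (Complex.continuous_ofReal.comp_continuousOn hf).mul hec
  have hsplit : (σ : ℂ) * Complex.I * ∫ x in (0 : ℝ)..2, ((amp x : ℝ) : ℂ) * e x =
      (((P 2 * u 2 : ℝ) : ℂ) * e 2 - ((P 0 * u 0 : ℝ) : ℂ) * e 0
      - ∫ x in (0 : ℝ)..2, ((P' x * u x + P x * u' x : ℝ) : ℂ) * e x)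
      + (σ : ℂ) * Complex.I * ∫ x in (0 : ℝ)..2, ((amp x * κ ^ 2 * K x : ℝ) : ℂ) * e x := by
    have i1 : IntervalIntegrable (fun x => ((P' x * u x + P x * u' x : ℝ) : ℂ) * e x) volume 0 2 :=
      hint ((hP'c.mul hu_c.continuousOn).add (hPc.mul hu'_c.continuousOn))
    have i2 : IntervalIntegrable (fun x => ((amp x : ℝ) : ℂ) * e x) volume 0 2 := hint hampc
    have i3 : IntervalIntegrable (fun x => ((amp x * κ ^ 2 * K x : ℝ) : ℂ) * e x) volume 0 2 :=
      hint ((hampc.mul (continuousOn_const (c := κ ^ 2))).mul hK_c.continuousOn)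
    rw [← hibp, sub_add_eq_add_sub, eq_sub_iff_add_eq, ← sub_eq_iff_eq_add, add_sub_right_comm,
      ← mul_sub, ← intervalIntegral.integral_sub i2 i3, ← intervalIntegral.integral_const_mul,
      ← intervalIntegral.integral_add _ i1]
    · apply intervalIntegral.integral_congr
      intro x _
      simp only
      push_cast
      ring
    · exact (i2.sub i3).const_mul _
  have hJ1 := mul_integral_inv_affine_sq_add_sq_le α β hκ
  have hJ2 := add_mul_integral_inv_affine_sq_add_sq_le α β hκ
  set J := ∫ x in (0 : ℝ)..2, 1 / ((α + β * x) ^ 2 + κ ^ 2) with hJ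
  have hJ' : J = ∫ x in (0 : ℝ)..2, K x := rfl
  have hP₀' : 0 < P₀ := by positivity
  have hend : ∀ x ∈ Icc (0 : ℝ) 2, ‖((P x * u x : ℝ) : ℂ) * e x‖ ≤ P₀ * (1 / (2 * κ)) := by
    intro x hx
    rw [norm_mul, hen, mul_one, Complex.norm_real, Real.norm_eq_abs, abs_mul,
      abs_of_nonneg (hP_le x hx).1]
    exact mul_le_mul (hP_le x hx).2 (hu_le x) (abs_nonneg _) hP₀'.le
  have hv' : ‖∫ x in (0 : ℝ)..2, ((P' x * u x + P x * u' x : ℝ) : ℂ) * e x‖ ≤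
      5 * P₀ / κ + P₀ * (π / κ) := by
    calc _ ≤ ∫ x in (0 : ℝ)..2, (5 * P₀ * (1 / (2 * κ)) + P₀ * |β| * K x) := by
          refine intervalIntegral.norm_integral_le_of_norm_le (by norm_num) ?_
            (Continuous.intervalIntegrable (by fun_prop) _ _)
          refine Eventually.of_forall fun x hx => ?_
          have hx := Ioc_subset_Icc_self hx
          rw [norm_mul, hen, mul_one, Complex.norm_real, Real.norm_eq_abs]
          refine (abs_add_le _ _).trans (add_le_add ?_ ?_)
          · rw [abs_mul]
            exact mul_le_mul (hP'_le x hx) (hu_le x) (abs_nonneg _) (by positivity)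
          · rw [abs_mul, abs_of_nonneg (hP_le x hx).1, mul_assoc]
            exact mul_le_mul (hP_le x hx).2 (hu'_le x) (abs_nonneg _) hP₀'.le
      _ = 5 * P₀ / κ + P₀ * (|β| * J) := by
          have : ∫ x in (0 : ℝ)..2, P₀ * |β| * K x = P₀ * |β| * ∫ x in (0 : ℝ)..2, K x :=
            intervalIntegral.integral_const_mul _ _
          rw [intervalIntegral.integral_add (by simp) (Continuous.intervalIntegrable
            (by fun_prop) _ _), this, hJ']
          simp only [intervalIntegral.integral_const, smul_eq_mul]
          field_simp
          ring
      _ ≤ _ := by gcongr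
  have hlow : ‖∫ x in (0 : ℝ)..2, ((amp x * κ ^ 2 * K x : ℝ) : ℂ) * e x‖ ≤ a₀ * κ ^ 2 * J := by
    rw [hJ', ← intervalIntegral.integral_const_mul]
    refine intervalIntegral.norm_integral_le_of_norm_le (by norm_num) ?_
      (Continuous.intervalIntegrable (by fun_prop) _ _)
    refine Eventually.of_forall fun x hx => ?_
    have hx := Ioc_subset_Icc_self hx
    have hKx : 0 ≤ K x := by have := hKpos x; simp only [hK]; positivity
    rw [norm_mul, hen, mul_one, Complex.norm_real, Real.norm_eq_abs, abs_of_nonneg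
      (mul_nonneg (mul_nonneg (hamp_le x hx).1 (sq_nonneg _)) hKx)]
    gcongr
    exact (hamp_le x hx).2
  have hσ' : 0 < |σ| := abs_pos.2 hσ
  set X := p₁ * m₂ - m₁ * p₂ with hXdef
  have hX' : 0 < |X| := abs_pos.2 hX
  have hJ0 : 0 ≤ J := intervalIntegral.integral_nonneg (by norm_num) fun x _ => by
    have := hKpos x; positivity
  have hXJ : |X| * J ≤ C * Q * (5 * π / κ) := by
    have : |X| ≤ C * Q * (|α| + |β|) := by
      rw [show X = p₁ * β - m₁ * α by simp only [hXdef, hα, hβ]; ring]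
      refine (abs_sub _ _).trans ?_
      rw [abs_mul, abs_mul, abs_of_nonneg hm₁.1, abs_of_nonneg (hm₁.1.trans hm₁.2)]
      nlinarith [abs_nonneg α, abs_nonneg β, hp₁.2, hm₁.2]
    calc |X| * J ≤ C * Q * (|α| + |β|) * J := by gcongr
      _ = C * Q * ((|α| + |β|) * J) := by ring
      _ ≤ _ := by gcongr
  have hJX : J ≤ C * Q * (5 * π / κ) / |X| := by rw [le_div_iff₀ hX']; linarith
  have hfin : |σ| * ‖∫ x in (0 : ℝ)..2, ((amp x : ℝ) : ℂ) * e x‖ ≤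
      10 * P₀ / κ + |σ| * (a₀ * κ ^ 2 * J) := by
    have hn : ‖(σ : ℂ) * Complex.I‖ = |σ| := by simp
    have := congrArg norm hsplit
    rw [norm_mul, hn] at this
    rw [this]
    refine (norm_add_le _ _).trans (add_le_add ?_ ?_)
    · refine (norm_sub_le _ _).trans ((add_le_add ((norm_sub_le _ _).trans (add_le_add
        (hend 2 (by simp)) (hend 0 (by simp)))) hv').trans ?_)
      have : P₀ * (1 / (2 * κ)) + P₀ * (1 / (2 * κ)) + (5 * P₀ / κ + P₀ * (π / κ)) =
          (6 + π) * P₀ / κ := by field_simp; ring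
      rw [this]
      gcongr
      linarith [Real.pi_le_four]
    · rw [norm_mul, hn]; gcongr
  calc _ ≤ (10 * P₀ / κ + |σ| * (a₀ * κ ^ 2 * J)) / |σ| := by
        rw [le_div_iff₀ hσ', mul_comm]; exact hfin
    _ = 10 * P₀ / (|σ| * κ) + a₀ * κ ^ 2 * J := by field_simp
    _ ≤ 10 * P₀ / (|σ| * κ) + a₀ * κ ^ 2 * (C * Q * (5 * π / κ) / |X|) := by gcongr
    _ = _ := by simp only [hP₀]; field_simp; ring

end Oscillation

namespace ReversedWord

/-- The reversed words of length `n` over the alphabet `A`. -/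
def words (A : Finset ℕ) : ℕ → Finset (List ℕ)
  | 0 => {[]}
  | n + 1 => (A ×ˢ words A n).image fun p => p.1 :: p.2

/-- The reversed words of length at most `n` over the alphabet `A`. -/
def wordsLE (A : Finset ℕ) (n : ℕ) : Finset (List ℕ) := (Finset.range (n + 1)).biUnion (words A)

/-- The words of length at most `n` whose size reaches `Q` exactly with their last letter. -/
noncomputable def cutset (A : Finset ℕ) (Q : ℝ) (n : ℕ) : Finset (List ℕ) :=
  (wordsLE A n).filter fun r => parentSize r < Q ∧ Q ≤ size r

variable {A : Finset ℕ} {N : ℕ} {Q R s : ℝ}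

lemma mem_words {n : ℕ} {l : List ℕ} : l ∈ words A n ↔ l.length = n ∧ ∀ a ∈ l, a ∈ A := by
  induction n generalizing l with
  | zero =>
    simp only [words, Finset.mem_singleton, List.length_eq_zero_iff]
    exact ⟨fun h => by simp [h], fun h => h.1⟩
  | succ n ih =>
    simp only [words, Finset.mem_image, Finset.mem_product, Prod.exists, ih]
    constructor
    · rintro ⟨a, l, ⟨ha, rfl, hl⟩, rfl⟩
      simpa using ⟨ha, hl⟩
    · cases l with
      | nil => simp
      | cons a l =>
        rintro ⟨h1, h2⟩
        exact ⟨a, l, ⟨h2 a (by simp), by simpa using h1, fun b hb => h2 b (by simp [hb])⟩, rfl⟩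

lemma mem_wordsLE {n : ℕ} {l : List ℕ} : l ∈ wordsLE A n ↔ l.length ≤ n ∧ ∀ a ∈ l, a ∈ A := by
  simp only [wordsLE, Finset.mem_biUnion, Finset.mem_range, mem_words]
  constructor
  · rintro ⟨k, hk, rfl, h⟩; exact ⟨by omega, h⟩
  · rintro ⟨h, h'⟩; exact ⟨_, by omega, rfl, h'⟩

lemma mem_cutset {n : ℕ} {l : List ℕ} : l ∈ cutset A Q n ↔
    (l.length ≤ n ∧ ∀ a ∈ l, a ∈ A) ∧ parentSize l < Q ∧ Q ≤ size l := by
  rw [cutset, Finset.mem_filter, mem_wordsLE]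

lemma parentSize_le_size {l : List ℕ} (hl : ∀ a ∈ l, 1 ≤ a) :
    3 / 2 * parentSize l ≤ size l := by
  cases l with
  | nil => simp [parentSize, size_nil]
  | cons a l =>
    exact size_cons_ge (hl a List.mem_cons_self) fun b hb => hl b (List.mem_cons_of_mem _ hb)

lemma parentSize_nonneg {l : List ℕ} (hl : ∀ a ∈ l, 1 ≤ a) : 0 ≤ parentSize l := by
  cases l with
  | nil => simp [parentSize]
  | cons a l => exact zero_le_one.trans (one_le_size fun b hb => hl b (List.mem_cons_of_mem _ hb))

lemma sum_words_succ {M : Type*} [AddCommMonoid M] (n : ℕ) (f : List ℕ → M) :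
    ∑ r ∈ words A (n + 1), f r = ∑ r ∈ words A n, ∑ a ∈ A, f (a :: r) := by
  rw [words, Finset.sum_image, Finset.sum_product_right]
  rintro ⟨a, l⟩ _ ⟨b, m⟩ _ h
  simpa using h

lemma sum_cutset_add_sum_words {M : Type*} [AddCommMonoid M] (hA : ∀ a ∈ A, 1 ≤ a) (hQ : 0 < Q)
    {Φ : List ℕ → M} (hΦ : ∀ r : List ℕ, (∀ a ∈ r, a ∈ A) → Φ r = ∑ a ∈ A, Φ (a :: r)) (n : ℕ) :
    Φ [] = ∑ r ∈ cutset A Q n, Φ r + ∑ r ∈ words A n with size r < Q, Φ r := by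
  induction n with
  | zero =>
    have : wordsLE A 0 = {[]} := by ext l; simp +contextual [mem_wordsLE]
    simp only [cutset, this, words, Finset.sum_filter, Finset.sum_singleton, parentSize, hQ, true_and]
    by_cases h : Q ≤ size []
    · simp [h, h.not_gt]
    · simp [h, not_le.1 h]
  | succ n ih =>
    have h1 : ∑ r ∈ words A n with size r < Q, Φ r =
        ∑ r ∈ words A (n + 1) with parentSize r < Q, Φ r := by
      rw [Finset.sum_filter, Finset.sum_filter, sum_words_succ]
      refine Finset.sum_congr rfl fun r hr => ?_
      by_cases h : size r < Q
      · simpa [parentSize, h] using hΦ r (mem_words.1 hr).2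
      · simp [parentSize, h]
    have h2 : cutset A Q (n + 1) = cutset A Q n ∪
        ((words A (n + 1)).filter fun r => parentSize r < Q ∧ Q ≤ size r) := by
      ext l
      simp only [mem_cutset, Finset.mem_union, Finset.mem_filter, mem_words]
      have : l.length ≤ n + 1 ↔ l.length ≤ n ∨ l.length = n + 1 := by omega
      rw [this]; tauto
    have h3 : Disjoint (cutset A Q n)
        ((words A (n + 1)).filter fun r => parentSize r < Q ∧ Q ≤ size r) := by
      rw [Finset.disjoint_left]
      intro l h h'
      simp only [mem_cutset, Finset.mem_filter, mem_words] at h h'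
      omega
    rw [ih, h1, h2, Finset.sum_union h3, add_assoc]
    congr 1
    rw [← Finset.sum_filter_add_sum_filter_not _ (fun r => Q ≤ size r), Finset.filter_filter,
      Finset.filter_filter]
    congr 2
    ext l
    simp only [Finset.mem_filter, not_le, mem_words, and_congr_right_iff]
    rintro ⟨-, h⟩
    have := parentSize_le_size fun a ha => hA a (h a ha)
    have := parentSize_nonneg fun a ha => hA a (h a ha)
    exact ⟨fun h => h.2, fun h => ⟨by linarith, h⟩⟩

lemma sum_cutset_eq {M : Type*} [AddCommMonoid M] (hA : ∀ a ∈ A, 1 ≤ a) (hQ : 0 < Q)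
    {Φ : List ℕ → M} (hΦ : ∀ r : List ℕ, (∀ a ∈ r, a ∈ A) → Φ r = ∑ a ∈ A, Φ (a :: r)) {n : ℕ}
    (hn : Q ≤ (3 / 2) ^ n) : Φ [] = ∑ r ∈ cutset A Q n, Φ r := by
  rw [sum_cutset_add_sum_words hA hQ hΦ n, Finset.filter_false_of_mem, Finset.sum_empty, add_zero]
  intro r hr
  obtain ⟨h1, h2⟩ := mem_words.1 hr
  have := pow_length_le_size fun a ha => hA a (h2 a ha)
  rw [h1] at this
  linarith

/-- An additive weight on the tree of reversed words dominating `size ^ (-2 * s)`. -/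
structure IsWeight (A : Finset ℕ) (s : ℝ) (W : List ℕ → ℝ) : Prop where
  nil : W [] = 1
  additive : ∀ r : List ℕ, (∀ a ∈ r, a ∈ A) → W r = ∑ a ∈ A, W (a :: r)
  lower : ∀ r : List ℕ, (∀ a ∈ r, a ∈ A) → size r ^ (-2 * s) ≤ W r

namespace IsWeight

variable {W : List ℕ → ℝ} (hW : IsWeight A s W) (hA : ∀ a ∈ A, 1 ≤ a ∧ a ≤ N)
include hW hA

lemma nonneg {r : List ℕ} (hr : ∀ a ∈ r, a ∈ A) : 0 ≤ W r :=
  (Real.rpow_nonneg (zero_le_one.trans (one_le_size fun a ha => (hA a (hr a ha)).1)) _).trans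
    (hW.lower r hr)

lemma sum_cutset_le (hQ : 0 < Q) (n : ℕ) : ∑ r ∈ cutset A Q n, W r ≤ 1 := by
  rw [← hW.nil, sum_cutset_add_sum_words (fun a ha => (hA a ha).1) hQ hW.additive n]
  refine le_add_of_nonneg_right (Finset.sum_nonneg fun r hr => hW.nonneg hA ?_)
  exact (mem_words.1 (Finset.mem_filter.1 hr).1).2

lemma sum_size_rpow_cutset_le (hQ : 0 < Q) (n : ℕ) :
    ∑ r ∈ cutset A Q n, size r ^ (-2 * s) ≤ 1 :=
  (Finset.sum_le_sum fun r hr => hW.lower r (mem_cutset.1 hr).1.2).trans (hW.sum_cutset_le hA hQ n)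

lemma sum_shells_le (hR : 0 < R) (n J : ℕ) :
    ∑ r ∈ wordsLE A n with R ≤ size r ∧ size r < (3 / 2) ^ J * R, W r ≤ J := by
  induction J with
  | zero =>
    rw [Finset.filter_false_of_mem]
    · simp
    · rintro r _ ⟨h1, h2⟩; linarith
  | succ J ih =>
    have hsub : ((wordsLE A n).filter fun r => R ≤ size r ∧ size r < (3 / 2) ^ (J + 1) * R) ⊆
        ((wordsLE A n).filter fun r => R ≤ size r ∧ size r < (3 / 2) ^ J * R) ∪
          cutset A ((3 / 2) ^ J * R) n := by
      intro r hr
      simp only [Finset.mem_filter, Finset.mem_union, cutset] at hr ⊢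
      obtain ⟨h1, h2, h3⟩ := hr
      by_cases h : size r < (3 / 2) ^ J * R
      · exact .inl ⟨h1, h2, h⟩
      · push Not at h
        refine .inr ⟨h1, ?_, h⟩
        have := parentSize_le_size fun a ha => (hA a ((mem_wordsLE.1 h1).2 a ha)).1
        rw [pow_succ] at h3
        linarith
    have hnn : ∀ r ∈ wordsLE A n, 0 ≤ W r := fun r hr => hW.nonneg hA (mem_wordsLE.1 hr).2
    refine (Finset.sum_le_sum_of_subset_of_nonneg hsub fun r hr _ => hnn r ?_).trans ?_
    · simp only [Finset.mem_filter, Finset.mem_union, cutset] at hr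
      tauto
    · refine (Finset.sum_union_inter (f := W) ▸ le_add_of_nonneg_right
        (Finset.sum_nonneg fun r hr => hnn r ?_)).trans (add_le_add ih
          (hW.sum_cutset_le hA (by positivity : 0 < (3 / 2 : ℝ) ^ J * R) n)) |>.trans_eq (by simp)
      exact (Finset.mem_filter.1 (Finset.mem_inter.1 hr).1).1

end IsWeight

lemma size_lt_of_mem_cutset (hA : ∀ a ∈ A, 1 ≤ a ∧ a ≤ N) (hN : 1 ≤ N) (hQ : 1 ≤ Q) {n : ℕ}
    {r : List ℕ} (hr : r ∈ cutset A Q n) : size r < (N + 1) * Q := by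
  obtain ⟨⟨-, h1⟩, h2, -⟩ := mem_cutset.1 hr
  have hN : (1 : ℝ) ≤ N := by exact_mod_cast hN
  cases r with
  | nil => rw [size_nil]; nlinarith
  | cons a l =>
    have := size_cons_le (hA a (h1 a (by simp))).2 (l := l)
      fun b hb => (hA b (h1 b (by simp [hb]))).1
    simp only [parentSize] at h2
    nlinarith

lemma IsWeight.sum_prefix_le {W : List ℕ → ℝ} (hW : IsWeight A s W)
    (hA : ∀ a ∈ A, 1 ≤ a ∧ a ≤ N) (hN : 1 ≤ N) (hs : 0 ≤ s) (hs1 : s ≤ 1) {J : ℕ}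
    (hJ : (2 * (N + 1) : ℝ) ≤ (3 / 2) ^ J) (hQ : 1 ≤ Q) (n : ℕ) {c : List ℕ}
    (hc : ∀ a ∈ c, a ∈ A) :
    ∑ r ∈ cutset A Q n with c <+: r, size r ^ (-2 * s) ≤ 4 * J * size c ^ (-2 * s) := by
  have hc' : ∀ a ∈ c, 1 ≤ a := fun a ha => (hA a (hc a ha)).1
  have hc1 := one_le_size hc'
  have hR : 0 < Q / size c := by positivity
  have hA1 : ∀ {l : List ℕ}, (∀ a ∈ l, a ∈ A) → ∀ a ∈ l, 1 ≤ a := fun h a ha => (hA a (h a ha)).1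
  calc ∑ r ∈ cutset A Q n with c <+: r, size r ^ (-2 * s)
      ≤ ∑ u ∈ wordsLE A n with Q / size c ≤ size u ∧ size u < (3 / 2) ^ J * (Q / size c),
          4 * size c ^ (-2 * s) * W u := by
        have himg : (cutset A Q n).filter (fun r => c <+: r) =
            ((wordsLE A n).filter fun u => c ++ u ∈ cutset A Q n).image (c ++ ·) := by
          ext r
          simp only [Finset.mem_filter, Finset.mem_image]
          constructor
          · rintro ⟨h, u, rfl⟩
            refine ⟨u, ⟨mem_wordsLE.2 ?_, h⟩, rfl⟩
            obtain ⟨⟨h1, h2⟩, -⟩ := mem_cutset.1 h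
            rw [List.length_append] at h1
            exact ⟨by omega, fun a ha => h2 a (by simp [ha])⟩
          · rintro ⟨u, ⟨-, h⟩, rfl⟩
            exact ⟨h, u, rfl⟩
        rw [himg, Finset.sum_image fun u _ v _ h => List.append_cancel_left h]
        have hu : ∀ u ∈ (wordsLE A n).filter (fun u => c ++ u ∈ cutset A Q n),
            (∀ a ∈ u, a ∈ A) ∧ (Q / size c ≤ size u ∧ size u < (3 / 2) ^ J * (Q / size c)) ∧
              size c * size u / 2 ≤ size (c ++ u) := by
          intro u hu
          obtain ⟨h1, h2⟩ := Finset.mem_filter.1 hu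
          have h3 := (mem_wordsLE.1 h1).2
          have h4 := size_append_le hc' (hA1 h3)
          have h5 := le_size_append hc' (hA1 h3)
          have h6 := size_lt_of_mem_cutset hA hN hQ h2
          refine ⟨h3, ⟨?_, ?_⟩, by linarith⟩
          · rw [div_le_iff₀ (by positivity)]
            linarith [(mem_cutset.1 h2).2.2]
          · rw [← mul_div_assoc, lt_div_iff₀ (by positivity)]
            calc size u * size c < 2 * (N + 1) * Q := by linarith
              _ ≤ _ := by gcongr
        refine (Finset.sum_le_sum fun u hu' => ?_).trans
          (Finset.sum_le_sum_of_subset_of_nonneg (fun u hu' => ?_) fun u hu' _ => ?_)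
        · obtain ⟨h1, -, h2⟩ := hu u hu'
          have hu1 := one_le_size (hA1 h1)
          calc size (c ++ u) ^ (-2 * s) ≤ (size c * size u / 2) ^ (-2 * s) :=
                Real.rpow_le_rpow_of_nonpos (by positivity) h2 (by linarith)
            _ = (2 : ℝ)⁻¹ ^ (-2 * s) * (size c ^ (-2 * s) * size u ^ (-2 * s)) := by
                rw [div_eq_mul_inv, mul_comm, Real.mul_rpow (by positivity) (by positivity),
                  Real.mul_rpow (by positivity) (by positivity)]
            _ ≤ 4 * (size c ^ (-2 * s) * W u) := by
                refine mul_le_mul ?_ (by gcongr; exact hW.lower u h1) (by positivity) (by norm_num)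
                rw [Real.inv_rpow (by norm_num), ← Real.rpow_neg (by norm_num)]
                calc (2 : ℝ) ^ (-(-2 * s)) ≤ 2 ^ (2 : ℝ) :=
                      Real.rpow_le_rpow_of_exponent_le (by norm_num) (by linarith)
                  _ = 4 := by norm_num
            _ = _ := by ring
        · exact Finset.mem_filter.2 ⟨(Finset.mem_filter.1 hu').1, (hu u hu').2.1⟩
        · have := hW.nonneg hA (mem_wordsLE.1 (Finset.mem_filter.1 hu').1).2
          positivity
    _ = 4 * size c ^ (-2 * s) * ∑ u ∈ wordsLE A n with
          Q / size c ≤ size u ∧ size u < (3 / 2) ^ J * (Q / size c), W u := by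
        rw [Finset.mul_sum]
    _ ≤ 4 * size c ^ (-2 * s) * J := by
        gcongr
        exact hW.sum_shells_le hA hR n J
    _ = _ := by ring

end ReversedWord

namespace ReversedWord

variable {A : Finset ℕ} {N n : ℕ} {Q s ξ τ : ℝ} {r r' : List ℕ}

/-- The contribution of the branch of `r` to the transfer operator applied to a character. -/
noncomputable def wave (s ξ : ℝ) (r : List ℕ) (x : ℝ) : ℂ :=
  ((jac r x ^ (-2 * s) : ℝ) : ℂ) * Complex.exp ((-(2 * π * ξ * branch r x) : ℝ) * Complex.I)

lemma continuous_jac (r : List ℕ) : Continuous (jac r) := by unfold jac; fun_prop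

lemma hasDerivAt_jac (r : List ℕ) (x : ℝ) : HasDerivAt (jac r) (prevDen r) x :=
  ((((hasDerivAt_id x).mul_const (prevDen r)).const_add (den r)).congr_deriv (one_mul _))

lemma jac_rpow_le (hr : ∀ a ∈ r, 1 ≤ a) (hs : 0 ≤ s) (hs1 : s ≤ 1) {x : ℝ} (hx : 0 ≤ x) :
    jac r x ^ (-2 * s) ≤ 4 * size r ^ (-2 * s) := by
  have h1 := one_le_size hr
  have h2 : size r / 2 ≤ jac r x := by linarith [den_le_jac hr hx, size_le_two_den hr]
  calc jac r x ^ (-2 * s) ≤ (size r / 2) ^ (-2 * s) :=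
        Real.rpow_le_rpow_of_nonpos (by positivity) h2 (by linarith)
    _ = (2 : ℝ) ^ (2 * s) * size r ^ (-2 * s) := by
        rw [div_eq_mul_inv, mul_comm, Real.mul_rpow (by positivity) (by positivity),
          Real.inv_rpow (by norm_num), ← Real.rpow_neg (by norm_num), neg_mul, neg_neg]
    _ ≤ 2 ^ (2 : ℝ) * size r ^ (-2 * s) := by
        gcongr
        · norm_num
        · linarith
    _ = _ := by norm_num

lemma norm_wave (hr : ∀ a ∈ r, 1 ≤ a) {x : ℝ} (hx : 0 ≤ x) :
    ‖wave s ξ r x‖ = jac r x ^ (-2 * s) := by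
  rw [wave, norm_mul, Complex.norm_exp_ofReal_mul_I, mul_one, Complex.norm_real, Real.norm_eq_abs,
    abs_of_nonneg (Real.rpow_nonneg (jac_pos hr hx).le _)]

lemma hasDerivAt_wave (hr : ∀ a ∈ r, 1 ≤ a) {x : ℝ} (hx : 0 ≤ x) :
    HasDerivAt (wave s ξ r) (wave s ξ r x * ((-2 * s * (prevDen r / jac r x) : ℝ) -
      (2 * π * ξ * ((-1) ^ r.length / jac r x ^ 2) : ℝ) * Complex.I)) x := by
  have hj := jac_pos hr hx
  have h1 := ((hasDerivAt_jac r x).rpow_const (p := -2 * s) (.inl hj.ne')).ofReal_comp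
  have h2 := ((((hasDerivAt_branch hr hx).const_mul (2 * π * ξ)).fun_neg.ofReal_comp).mul_const
    Complex.I).cexp
  refine (h1.mul h2).congr_deriv ?_
  rw [wave, Real.rpow_sub_one hj.ne']
  have hj' : (jac r x : ℂ) ≠ 0 := by exact_mod_cast hj.ne'
  push_cast
  field_simp
  ring

lemma continuousOn_wave (hr : ∀ a ∈ r, 1 ≤ a) : ContinuousOn (wave s ξ r) (Icc 0 2) :=
  fun _ hx => (hasDerivAt_wave hr hx.1).continuousAt.continuousWithinAt

lemma norm_wave_sub_le (hr : ∀ a ∈ r, 1 ≤ a) (hs : 0 ≤ s) (hs1 : s ≤ 1) (hQ : 1 ≤ Q)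
    (hQr : Q ≤ size r) (hξ : |ξ| = Q ^ 4) {x y : ℝ} (hx : x ∈ Icc (0 : ℝ) 2)
    (hy : y ∈ Icc (0 : ℝ) 2) :
    ‖wave s ξ r y - wave s ξ r x‖ ≤ 4 * size r ^ (-2 * s) * (34 * Q ^ 2) * |y - x| := by
  refine (convex_Icc (0 : ℝ) 2).norm_image_sub_le_of_norm_hasDerivWithin_le
    (fun z hz => (hasDerivAt_wave hr hz.1).hasDerivWithinAt) (fun z hz => ?_) hx hy
  have hj := jac_pos hr hz.1
  obtain ⟨d1, d2, d3⟩ := den_bounds hr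
  have hdj := den_le_jac hr hz.1
  have hj2 : Q / 2 ≤ jac r z := by linarith [size_le_two_den hr]
  rw [norm_mul, norm_wave hr hz.1]
  refine mul_le_mul (jac_rpow_le hr hs hs1 hz.1) ?_ (norm_nonneg _)
    (mul_nonneg (by norm_num) (Real.rpow_nonneg (by linarith) _))
  refine (norm_sub_le _ _).trans ?_
  rw [norm_mul, Complex.norm_I, mul_one, Complex.norm_real, Complex.norm_real, Real.norm_eq_abs,
    Real.norm_eq_abs, abs_mul, abs_mul, abs_mul, abs_mul, abs_mul, abs_div, abs_div, abs_neg_one_pow, abs_neg,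
    hξ, abs_of_nonneg hs, abs_of_nonneg d2, abs_of_pos hj, abs_of_pos (pow_pos hj 2),
    abs_of_pos Real.pi_pos, abs_two]
  have e1 : prevDen r / jac r z ≤ 1 := (div_le_one hj).2 (d3.trans hdj)
  have e2 : Q ^ 4 * (1 / jac r z ^ 2) ≤ 4 * Q ^ 2 := by
    rw [mul_one_div, div_le_iff₀ (by positivity)]
    have : (Q / 2) ^ 2 ≤ jac r z ^ 2 := by gcongr
    nlinarith [sq_nonneg Q]
  have e3 : 0 ≤ prevDen r / jac r z := by positivity
  have e4 : 2 * s * (prevDen r / jac r z) ≤ 2 * 1 := by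
    refine mul_le_mul (by linarith) e1 e3 (by norm_num)
  have e5 : 2 * π * Q ^ 4 * (1 / jac r z ^ 2) ≤ 8 * (4 * Q ^ 2) := by
    rw [mul_assoc]
    exact mul_le_mul (by linarith [Real.pi_le_four]) e2 (by positivity) (by norm_num)
  nlinarith

lemma wave_mul_conj (hr : ∀ a ∈ r, 1 ≤ a) (hr' : ∀ a ∈ r', 1 ≤ a) {x : ℝ} (hx : 0 ≤ x) :
    wave s ξ r x * (starRingEnd ℂ) (wave s ξ r' x) =
      (((den r + x * prevDen r) * (den r' + x * prevDen r')) ^ (-2 * s) : ℝ) *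
        Complex.exp ((-(2 * π * ξ) * (branch r x - branch r' x) : ℝ) * Complex.I) := by
  have h1 := (jac_pos hr hx).le
  have h2 := (jac_pos hr' hx).le
  rw [← jac, ← jac, Real.mul_rpow h1 h2, wave, wave, map_mul, Complex.conj_ofReal,
    ← Complex.exp_conj, map_mul, Complex.conj_ofReal, Complex.conj_I, mul_mul_mul_comm,
    ← Complex.exp_add]
  push_cast
  congr 2
  ring

set_option maxHeartbeats 1000000 in
lemma norm_integral_wave_mul_conj_le (hA : ∀ a ∈ A, 1 ≤ a ∧ a ≤ N) (hN : 1 ≤ N) (hs : 0 < s)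
    (hs1 : s ≤ 1) (hQ : 1 ≤ Q) (hξ : |ξ| = Q ^ 4) (hr : r ∈ cutset A Q n)
    (hr' : r' ∈ cutset A Q n) (hτ : (-1 : ℝ) ^ r.length = τ) (hτ' : (-1 : ℝ) ^ r'.length = τ) :
    ∃ c, c <+: r ∧ c <+: r' ∧
      ‖∫ x in (0 : ℝ)..2, wave s ξ r x * (starRingEnd ℂ) (wave s ξ r' x)‖ ≤
        32 * (N + 1) ^ 2 * (270 * (N + 1) ^ 3 + 5 * π * (N + 1)) * Q ^ (-4 * s) / Q * size c := by
  have hA1 : ∀ {l : List ℕ}, (∀ a ∈ l, a ∈ A) → ∀ a ∈ l, 1 ≤ a := fun h a ha => (hA a (h a ha)).1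
  have hrA := (mem_cutset.1 hr).1.2
  have hrA' := (mem_cutset.1 hr').1.2
  have hQr := (mem_cutset.1 hr).2.2
  have hQr' := (mem_cutset.1 hr').2.2
  have hr1 := hA1 hrA
  have hr1' := hA1 hrA'
  have hQ0 : 0 < Q := by linarith
  have hN1 : (1 : ℝ) ≤ N := by exact_mod_cast hN
  set C : ℝ := N + 1 with hC
  have hC1 : 1 ≤ C := by linarith
  have hcongr : ∫ x in (0 : ℝ)..2, wave s ξ r x * (starRingEnd ℂ) (wave s ξ r' x) =
      ∫ x in (0 : ℝ)..2, (((den r + x * prevDen r) * (den r' + x * prevDen r')) ^ (-2 * s) : ℝ) *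
        Complex.exp ((-(2 * π * ξ) * (branch r x - branch r' x) : ℝ) * Complex.I) := by
    refine intervalIntegral.integral_congr fun x hx => ?_
    rw [uIcc_of_le (by norm_num)] at hx
    exact wave_mul_conj hr1 hr1' hx.1
  have ha₀ : ((Q / 2) * (Q / 2)) ^ (-2 * s) ≤ 16 * Q ^ (-4 * s) := by
    rw [show Q / 2 * (Q / 2) = (4 : ℝ)⁻¹ * (Q ^ (2 : ℝ)) by rw [Real.rpow_two]; ring,
      Real.mul_rpow (by norm_num) (by positivity), ← Real.rpow_mul hQ0.le,
      Real.inv_rpow (by norm_num), ← Real.rpow_neg (by norm_num)]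
    rw [show 2 * (-2 * s) = -4 * s by ring]
    gcongr
    calc (4 : ℝ) ^ (-(-2 * s)) ≤ 4 ^ (2 : ℝ) :=
          Real.rpow_le_rpow_of_exponent_le (by norm_num) (by linarith)
      _ = 16 := by norm_num
  have hbd : ∀ {r : List ℕ}, r ∈ cutset A Q n → Q / 2 ≤ den r ∧ den r ≤ C * Q ∧
      0 ≤ prevDen r ∧ prevDen r ≤ den r := by
    intro r hr
    have h1 := hA1 (mem_cutset.1 hr).1.2
    obtain ⟨d1, d2, d3⟩ := den_bounds h1
    exact ⟨by linarith [size_le_two_den h1, (mem_cutset.1 hr).2.2],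
      (den_le_size h1).trans (size_lt_of_mem_cutset hA hN hQ hr).le, d2, d3⟩
  obtain ⟨p1, p2, p3, p4⟩ := hbd hr
  obtain ⟨p1', p2', p3', p4'⟩ := hbd hr'
  obtain ⟨c, u, v, hcu, hcv, huv⟩ := exists_common_prefix r r'
  refine ⟨c, ⟨u, hcu.symm⟩, ⟨v, hcv.symm⟩, ?_⟩
  have hcA : ∀ a ∈ c, a ∈ A := fun a ha => hrA a (by simp [hcu, ha])
  have huA : ∀ a ∈ u, a ∈ A := fun a ha => hrA a (by simp [hcu, ha])
  have hvA : ∀ a ∈ v, a ∈ A := fun a ha => hrA' a (by simp [hcv, ha])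
  have hc1 := one_le_size (hA1 hcA)
  set D := 270 * C ^ 3 + 5 * π * C with hD
  have hD1 : 2 ≤ D := by
    have := Real.pi_pos
    have : 1 ≤ C ^ 3 := one_le_pow₀ hC1
    have : 0 ≤ 5 * π * C := by positivity
    linarith
  rw [hcongr]
  have hu0 := size_append_le (hA1 hcA) (hA1 huA)
  have hv0 := size_append_le (hA1 hcA) (hA1 hvA)
  rw [← hcu] at hu0
  rw [← hcv] at hv0
  have hshort : ∀ w : List ℕ, (∀ a ∈ w, a ∈ A) → w.length ≤ 1 → size w ≤ C := by
    intro w hw hlen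
    match w, hlen with
    | [], _ => rw [size_nil]; exact hC1
    | [a], _ =>
      have := size_cons_le (hA a (hw a (by simp))).2 (l := []) (by simp)
      simpa [size_nil] using this
  have hdeg : Q ≤ C * size c → ‖∫ x in (0 : ℝ)..2,
      (((den r + x * prevDen r) * (den r' + x * prevDen r')) ^ (-2 * s) : ℝ) *
        Complex.exp ((-(2 * π * ξ) * (branch r x - branch r' x) : ℝ) * Complex.I)‖ ≤
      32 * C ^ 2 * D * Q ^ (-4 * s) / Q * size c := by
    intro hQc
    have := intervalIntegral.norm_integral_le_of_norm_le_const (a := (0 : ℝ)) (b := 2)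
      (C := 16 * Q ^ (-4 * s)) (f := fun x => ((((den r + x * prevDen r) *
        (den r' + x * prevDen r')) ^ (-2 * s) : ℝ) : ℂ) *
        Complex.exp ((-(2 * π * ξ) * (branch r x - branch r' x) : ℝ) * Complex.I)) (by
      intro x hx
      rw [uIoc_of_le (by norm_num)] at hx
      rw [norm_mul, Complex.norm_exp_ofReal_mul_I, mul_one, Complex.norm_real, Real.norm_eq_abs]
      have h1 : Q / 2 ≤ den r + x * prevDen r := by nlinarith [hx.1]
      have h2 : Q / 2 ≤ den r' + x * prevDen r' := by nlinarith [hx.1]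
      rw [abs_of_nonneg (Real.rpow_nonneg (by nlinarith) _)]
      refine (Real.rpow_le_rpow_of_nonpos (by positivity) ?_ (by linarith)).trans ha₀
      exact mul_le_mul h1 h2 (by positivity) (by linarith))
    refine this.trans ?_
    rw [sub_zero, abs_two]
    have h1 : 1 ≤ C * size c / Q := by rwa [one_le_div hQ0]
    have h2 : 1 ≤ C * D := by nlinarith
    have h3 : 0 ≤ Q ^ (-4 * s) := by positivity
    calc 16 * Q ^ (-4 * s) * 2 = 32 * Q ^ (-4 * s) * (1 * 1) := by ring
      _ ≤ 32 * Q ^ (-4 * s) * (C * size c / Q * (C * D)) := by gcongr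
      _ = _ := by ring
  rcases huv with hu | hv | ⟨a, b, u', v', hab, hu', hv', rfl, rfl⟩
  · exact hdeg (by nlinarith [hshort u huA hu])
  · exact hdeg (by nlinarith [hshort v hvA hv])
  · have huA' : ∀ a ∈ u', a ∈ A := fun a ha => huA a (by simp [ha])
    have hvA' : ∀ a ∈ v', a ∈ A := fun a ha => hvA a (by simp [ha])
    have hX := den_mul_le_cross hab (fun a ha => hA a (huA' a ha)) (fun a ha => hA a (hvA' a ha))
      hu' hv'
    rw [← abs_cross_append c, ← hcu, ← hcv] at hX
    have hden : ∀ (a : ℕ) (w : List ℕ), (∀ b ∈ a :: w, b ∈ A) → Q ≤ size c * size (a :: w) →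
        Q / (2 * C * size c) ≤ den w := by
      intro a w hw h
      have hw' : ∀ b ∈ w, b ∈ A := fun b hb => hw b (by simp [hb])
      have h1 := size_cons_le (hA a (hw a (by simp))).2 (hA1 hw')
      have h2 := size_le_two_den (hA1 hw')
      rw [div_le_iff₀ (by positivity)]
      calc Q ≤ size c * size (a :: w) := h
        _ ≤ size c * (C * (2 * den w)) := by gcongr; exact h1.trans (by gcongr)
        _ = _ := by ring
    have hdu := hden a u' huA (by linarith)
    have hdv := hden b v' hvA (by linarith)
    set X := cross r r' with hXdef
    have hXlow : (Q / (2 * C ^ 2 * size c)) ^ 2 ≤ |X| := by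
      have h1 : (Q / (2 * C * size c)) ^ 2 ≤ C * |X| := by
        rw [sq]; exact (mul_le_mul hdu hdv (by positivity)
          (le_trans (by positivity) hdu)).trans hX
      have h2 : (Q / (2 * C ^ 2 * size c)) ^ 2 = (Q / (2 * C * size c)) ^ 2 / C ^ 2 := by
        field_simp
      rw [h2, div_le_iff₀ (by positivity)]
      refine h1.trans ?_
      calc C * |X| ≤ C * |X| * C := le_mul_of_one_le_right (by positivity) hC1
        _ = _ := by ring
    have hX0 : 0 < |X| := lt_of_lt_of_le (by positivity) hXlow
    have hξ0 : 0 < |ξ| := by rw [hξ]; positivity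
    have hτ1 : |τ| = 1 := by rw [← hτ]; simp
    set σ := -(2 * π * ξ) * τ with hσdef
    have hσabs : |σ| = 2 * π * Q ^ 4 := by
      rw [hσdef, abs_mul, abs_neg, abs_mul, hτ1, hξ, abs_of_pos (by positivity : 0 < 2 * π)]; ring
    have hσ0 : 0 < |σ| := by rw [hσabs]; positivity
    set t := √|σ|
    set y := √|X|
    have ht : 0 < t := Real.sqrt_pos.2 hσ0
    have hy : 0 < y := Real.sqrt_pos.2 hX0
    have ht2 : |σ| = t ^ 2 := (Real.sq_sqrt hσ0.le).symm
    have hy2 : |X| = y ^ 2 := (Real.sq_sqrt hX0.le).symm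
    have ht3 : Q ^ 2 ≤ t := by
      apply Real.le_sqrt_of_sq_le
      rw [hσabs]
      have := Real.pi_gt_three
      have : 0 < Q ^ 4 := by positivity
      nlinarith
    have hy3 : Q / (2 * C ^ 2 * size c) ≤ y := Real.le_sqrt_of_sq_le hXlow
    have hmain := norm_integral_amplitude_le (p₁ := den r) (p₂ := den r') (m₁ := prevDen r)
      (m₂ := prevDen r') (σ := σ) (κ := Q * y / t) (C := C)
      (g := fun x => -(2 * π * ξ) * (branch r x - branch r' x)) hs hs1 hQ0 hC1 (by positivity)
      (abs_pos.1 hσ0) ⟨p1, p2⟩ ⟨p1', p2'⟩ ⟨p3, p4⟩ ⟨p3', p4'⟩ (abs_pos.1 hX0) (by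
        intro x hx
        refine (((hasDerivAt_branch hr1 hx.1).sub (hasDerivAt_branch hr1' hx.1)).const_mul
          (-(2 * π * ξ))).congr_deriv ?_
        rw [hτ, hτ', hσdef]
        simp only [jac]
        ring)
    refine hmain.trans ?_
    have e1 : 270 * C ^ 3 * Q ^ 3 / (|σ| * (Q * y / t)) + Q * y / t * (5 * π) * (C * Q) / |X| =
        D * (Q ^ 2 / (t * y)) := by
      rw [ht2, hy2, hD]
      field_simp
    have e2 : Q ^ 2 / (t * y) ≤ 2 * C ^ 2 * size c / Q := by
      calc Q ^ 2 / (t * y) ≤ Q ^ 2 / (Q ^ 2 * (Q / (2 * C ^ 2 * size c))) := by gcongr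
        _ = _ := by field_simp
    change _ * (270 * C ^ 3 * Q ^ 3 / (|σ| * (Q * y / t)) +
      Q * y / t * (5 * π) * (C * Q) / |X|) ≤ _
    rw [e1]
    calc _ ≤ 16 * Q ^ (-4 * s) * (D * (2 * C ^ 2 * size c / Q)) := by gcongr
      _ = _ := by ring

end ReversedWord

namespace ReversedWord

variable {A : Finset ℕ} {N n J : ℕ} {Q s ξ τ : ℝ} {W : List ℕ → ℝ}

lemma rpow_le_of_mem_cutset (hA : ∀ a ∈ A, 1 ≤ a ∧ a ≤ N) (hN : 1 ≤ N) (hs : 0 ≤ s)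
    (hs1 : s ≤ 1) (hQ : 1 ≤ Q) {r : List ℕ} (hr : r ∈ cutset A Q n) :
    Q ^ (-2 * s) ≤ (N + 1) ^ 2 * size r ^ (-2 * s) := by
  have h1 := size_lt_of_mem_cutset hA hN hQ hr
  have h2 : 0 < size r := lt_of_lt_of_le (by linarith) (mem_cutset.1 hr).2.2
  have hN0 : (0 : ℝ) < N + 1 := by positivity
  calc Q ^ (-2 * s) ≤ (((N : ℝ) + 1)⁻¹ * size r) ^ (-2 * s) := by
        refine Real.rpow_le_rpow_of_nonpos (by positivity) ?_ (by linarith)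
        rw [inv_mul_le_iff₀ hN0]; exact h1.le
    _ = ((N : ℝ) + 1) ^ (2 * s) * size r ^ (-2 * s) := by
        rw [Real.mul_rpow (by positivity) h2.le, Real.inv_rpow hN0.le, ← Real.rpow_neg hN0.le,
          neg_mul, neg_neg]
    _ ≤ ((N : ℝ) + 1) ^ (2 : ℝ) * size r ^ (-2 * s) := by
        gcongr
        · linarith
        · linarith
    _ = _ := by rw [Real.rpow_two]

/-- The constant in the energy estimate for sums of waves. -/
noncomputable def energyConst (N J : ℕ) (s : ℝ) : ℝ :=
  32 * (N + 1) ^ 2 * (270 * (N + 1) ^ 3 + 5 * π * (N + 1)) * (4 * J) * (N + 1) ^ 4 /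
    (1 - (3 / 2) ^ (1 - 2 * s))

lemma integral_norm_sum_sq_le {ι : Type*} (S : Finset ι) (f : ι → ℝ → ℂ)
    (hf : ∀ i ∈ S, ContinuousOn (f i) (Icc 0 2)) :
    ∫ x in (0 : ℝ)..2, ‖∑ i ∈ S, f i x‖ ^ 2 ≤
      ∑ i ∈ S, ∑ j ∈ S, ‖∫ x in (0 : ℝ)..2, f i x * (starRingEnd ℂ) (f j x)‖ := by
  have hint : ∀ i ∈ S, ∀ j ∈ S,
      IntervalIntegrable (fun x => f i x * (starRingEnd ℂ) (f j x)) volume 0 2 := by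
    intro i hi j hj
    apply ContinuousOn.intervalIntegrable
    rw [uIcc_of_le (by norm_num)]
    exact (hf i hi).mul (Complex.continuous_conj.comp_continuousOn (hf j hj))
  have h0 : 0 ≤ ∫ x in (0 : ℝ)..2, ‖∑ i ∈ S, f i x‖ ^ 2 :=
    intervalIntegral.integral_nonneg (by norm_num) fun x _ => by positivity
  have h1 : ((∫ x in (0 : ℝ)..2, ‖∑ i ∈ S, f i x‖ ^ 2 : ℝ) : ℂ) =
      ∑ i ∈ S, ∑ j ∈ S, ∫ x in (0 : ℝ)..2, f i x * (starRingEnd ℂ) (f j x) := by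
    rw [← intervalIntegral.integral_ofReal]
    calc _ = ∫ x in (0 : ℝ)..2, ∑ i ∈ S, ∑ j ∈ S, f i x * (starRingEnd ℂ) (f j x) := by
          refine intervalIntegral.integral_congr fun x _ => ?_
          rw [← Finset.sum_mul_sum, ← map_sum, Complex.mul_conj']
          push_cast
          rfl
      _ = _ := by
          simp only [← Finset.sum_product']
          exact intervalIntegral.integral_finsetSum fun p hp =>
            hint _ (Finset.mem_product.1 hp).1 _ (Finset.mem_product.1 hp).2
  rw [← abs_of_nonneg h0, ← Real.norm_eq_abs, ← Complex.norm_real, h1]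
  exact (norm_sum_le _ _).trans (Finset.sum_le_sum fun i _ => norm_sum_le _ _)

lemma integral_sq_sum_wave_le (hW : IsWeight A s W) (hA : ∀ a ∈ A, 1 ≤ a ∧ a ≤ N) (hN : 1 ≤ N)
    (hs : 1 / 2 < s) (hs1 : s ≤ 1) (hJ : (2 * (N + 1) : ℝ) ≤ (3 / 2) ^ J) (hQ : 1 ≤ Q)
    (hξ : |ξ| = Q ^ 4) {S : Finset (List ℕ)} (hS : S ⊆ cutset A Q n)
    (hτ : ∀ r ∈ S, (-1 : ℝ) ^ r.length = τ) :
    ∫ x in (0 : ℝ)..2, ‖∑ r ∈ S, wave s ξ r x‖ ^ 2 ≤ energyConst N J s / Q := by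
  have hs0 : 0 < s := by linarith
  have hQ0 : 0 < Q := by linarith
  have hSA : ∀ r ∈ S, ∀ a ∈ r, a ∈ A := fun r hr => (mem_cutset.1 (hS hr)).1.2
  have hA1 : ∀ {l : List ℕ}, (∀ a ∈ l, a ∈ A) → ∀ a ∈ l, 1 ≤ a := fun h a ha => (hA a (h a ha)).1
  refine (integral_norm_sum_sq_le S (wave s ξ) fun r hr =>
    continuousOn_wave (hA1 (hSA r hr))).trans ?_
  set K : ℝ := 32 * (N + 1) ^ 2 * (270 * (N + 1) ^ 3 + 5 * π * (N + 1)) with hK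
  have hK0 : 0 ≤ K := by positivity
  set q : ℝ := (3 / 2) ^ (1 - 2 * s) with hq
  have hq0 : 0 < q := by positivity
  have hq1 : q < 1 := Real.rpow_lt_one_of_one_lt_of_neg (by norm_num) (by linarith)
  have hcount : ∀ c : List ℕ, (∀ a ∈ c, a ∈ A) →
      ∑ r ∈ cutset A Q n with c <+: r, Q ^ (-2 * s) ≤
        (N + 1) ^ 2 * (4 * J) * size c ^ (-2 * s) := by
    intro c hc
    calc _ ≤ ∑ r ∈ cutset A Q n with c <+: r, ((N : ℝ) + 1) ^ 2 * size r ^ (-2 * s) :=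
          Finset.sum_le_sum fun r hr =>
            rpow_le_of_mem_cutset hA hN hs0.le hs1 hQ (Finset.mem_filter.1 hr).1
      _ ≤ ((N : ℝ) + 1) ^ 2 * (4 * J * size c ^ (-2 * s)) := by
          rw [← Finset.mul_sum]
          gcongr
          exact hW.sum_prefix_le hA hN hs0.le hs1 hJ hQ n hc
      _ = _ := by ring
  have hrow : ∀ r ∈ S, ∑ r' ∈ S, ‖∫ x in (0 : ℝ)..2, wave s ξ r x *
      (starRingEnd ℂ) (wave s ξ r' x)‖ ≤
        K * (4 * J) * (N + 1) ^ 2 / (1 - q) / Q * Q ^ (-2 * s) := by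
    intro r hr
    have hterm : ∀ r' ∈ S, ‖∫ x in (0 : ℝ)..2, wave s ξ r x * (starRingEnd ℂ) (wave s ξ r' x)‖ ≤
        ∑ k ∈ Finset.range (r.length + 1),
          if r.take k <+: r' then K * Q ^ (-4 * s) / Q * size (r.take k) else 0 := by
      intro r' hr'
      obtain ⟨c, hc, hc', h⟩ := norm_integral_wave_mul_conj_le hA hN hs0 hs1 hQ hξ (hS hr) (hS hr')
        (hτ r hr) (hτ r' hr')
      have hck := List.prefix_iff_eq_take.1 hc
      refine h.trans ?_
      refine le_trans ?_ (Finset.single_le_sum (a := c.length) (fun k _ => ?_)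
        (Finset.mem_range.2 (Nat.lt_succ_of_le hc.length_le)))
      · rw [← hck, if_pos hc']
      · split_ifs
        · have := one_le_size (hA1 fun a ha => hSA r hr a (List.mem_of_mem_take ha) :
            ∀ a ∈ r.take k, 1 ≤ a)
          positivity
        · exact le_rfl
    refine (Finset.sum_le_sum hterm).trans ?_
    rw [Finset.sum_comm]
    have hk : ∀ k ∈ Finset.range (r.length + 1), ∑ r' ∈ S,
        (if r.take k <+: r' then K * Q ^ (-4 * s) / Q * size (r.take k) else 0) ≤
          K * (4 * J) * (N + 1) ^ 2 / Q * Q ^ (-2 * s) * q ^ k := by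
      intro k hk
      have hcA : ∀ a ∈ r.take k, a ∈ A := fun a ha => hSA r hr a (List.mem_of_mem_take ha)
      set c := r.take k with hc
      have hc1 := one_le_size (hA1 hcA)
      have hck : (3 / 2 : ℝ) ^ k ≤ size c := by
        have := pow_length_le_size (hA1 hcA)
        rwa [hc, List.length_take, min_eq_left (Nat.lt_succ_iff.1 (Finset.mem_range.1 hk))] at this
      have hq' : size c ^ (1 - 2 * s) ≤ q ^ k := by
        rw [hq, ← Real.rpow_natCast, ← Real.rpow_mul (by norm_num), mul_comm _ (k : ℝ),
          Real.rpow_mul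
          (by norm_num), Real.rpow_natCast]
        exact Real.rpow_le_rpow_of_nonpos (by positivity) hck (by linarith)
      calc _ ≤ ∑ r' ∈ cutset A Q n,
              (if c <+: r' then K * Q ^ (-4 * s) / Q * size c else 0) :=
            Finset.sum_le_sum_of_subset_of_nonneg hS fun r' _ _ => by split_ifs <;> positivity
        _ = K * Q ^ (-2 * s) / Q * size c * ∑ r' ∈ cutset A Q n with c <+: r', Q ^ (-2 * s) := by
            rw [← Finset.sum_filter, Finset.mul_sum]
            refine Finset.sum_congr rfl fun r' _ => ?_
            rw [show -4 * s = -2 * s + -2 * s by ring, Real.rpow_add hQ0]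
            ring
        _ ≤ K * Q ^ (-2 * s) / Q * size c * ((N + 1) ^ 2 * (4 * J) * size c ^ (-2 * s)) := by
            gcongr
            exact hcount c hcA
        _ = K * (4 * J) * (N + 1) ^ 2 / Q * Q ^ (-2 * s) * size c ^ (1 - 2 * s) := by
            rw [show 1 - 2 * s = 1 + -2 * s by ring, Real.rpow_add (by linarith), Real.rpow_one]
            ring
        _ ≤ _ := by gcongr
    refine (Finset.sum_le_sum hk).trans ?_
    rw [← Finset.mul_sum]
    have hgeom : ∑ k ∈ Finset.range (r.length + 1), q ^ k ≤ 1 / (1 - q) := by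
      have h1 := geom_sum_mul_neg q (r.length + 1)
      rw [le_div_iff₀ (by linarith), h1]
      have := pow_pos hq0 (r.length + 1)
      linarith
    calc _ ≤ K * (4 * J) * (N + 1) ^ 2 / Q * Q ^ (-2 * s) * (1 / (1 - q)) := by gcongr
      _ = _ := by ring
  refine (Finset.sum_le_sum hrow).trans ?_
  rw [← Finset.mul_sum]
  have htot : ∑ r ∈ S, Q ^ (-2 * s) ≤ ((N : ℝ) + 1) ^ 2 := by
    calc _ ≤ ∑ r ∈ cutset A Q n, Q ^ (-2 * s) :=
          Finset.sum_le_sum_of_subset_of_nonneg hS fun _ _ _ => by positivity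
      _ ≤ ∑ r ∈ cutset A Q n, ((N : ℝ) + 1) ^ 2 * size r ^ (-2 * s) :=
          Finset.sum_le_sum fun r hr => rpow_le_of_mem_cutset hA hN hs0.le hs1 hQ hr
      _ ≤ ((N : ℝ) + 1) ^ 2 * 1 := by
          rw [← Finset.mul_sum]
          gcongr
          exact hW.sum_size_rpow_cutset_le hA hQ0 n
      _ = _ := mul_one _
  have hq1' : 0 < 1 - q := by linarith
  calc _ ≤ K * (4 * J) * (N + 1) ^ 2 / (1 - q) / Q * ((N : ℝ) + 1) ^ 2 := by gcongr
    _ = _ := by rw [energyConst]; ring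

lemma norm_sum_wave_sub_le (hW : IsWeight A s W) (hA : ∀ a ∈ A, 1 ≤ a ∧ a ≤ N)
    (hs : 0 ≤ s) (hs1 : s ≤ 1) (hQ : 1 ≤ Q) (hξ : |ξ| = Q ^ 4) {S : Finset (List ℕ)}
    (hS : S ⊆ cutset A Q n) {x y : ℝ} (hx : x ∈ Icc (0 : ℝ) 2) (hy : y ∈ Icc (0 : ℝ) 2) :
    ‖∑ r ∈ S, wave s ξ r y - ∑ r ∈ S, wave s ξ r x‖ ≤ 136 * Q ^ 2 * |y - x| := by
  have hA1 : ∀ r ∈ cutset A Q n, ∀ a ∈ r, 1 ≤ a :=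
    fun r hr a ha => (hA a ((mem_cutset.1 hr).1.2 a ha)).1
  rw [← Finset.sum_sub_distrib]
  calc _ ≤ ∑ r ∈ S, 136 * Q ^ 2 * |y - x| * size r ^ (-2 * s) := by
        refine norm_sum_le_of_le _ fun r hr => ?_
        have := norm_wave_sub_le (hA1 r (hS hr)) hs hs1 hQ (mem_cutset.1 (hS hr)).2.2 hξ hx hy
        linarith
    _ ≤ ∑ r ∈ cutset A Q n, 136 * Q ^ 2 * |y - x| * size r ^ (-2 * s) :=
        Finset.sum_le_sum_of_subset_of_nonneg hS fun r hr _ => by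
          have := one_le_size (hA1 r hr)
          positivity
    _ ≤ 136 * Q ^ 2 * |y - x| * 1 := by
        rw [← Finset.mul_sum]
        gcongr
        exact hW.sum_size_rpow_cutset_le hA (by linarith) n
    _ = _ := mul_one _

end ReversedWord

open ReversedWord

/-- An `s`-conformal probability measure for the inverse branches of the Gauss map with digits in
`A`, where `N` bounds the digits. -/
structure IsConformal (A : Finset ℕ) (N : ℕ) (s : ℝ) (μ : Measure ℝ) : Prop where
  prob : IsProbabilityMeasure μ
  support : ∀ᵐ x ∂μ, 0 ≤ x ∧ x ≤ 1 - 1 / ((N : ℝ) + 2)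
  transfer : μ = ∑ a ∈ A,
    Measure.map (invBranch1 a) (μ.withDensity fun x => ENNReal.ofReal ((x + a) ^ (-2 * s)))

lemma measurable_invBranch1 (a : ℕ) : Measurable (invBranch1 a) := by
  unfold invBranch1; fun_prop

namespace ReversedWord

lemma measurable_branch (r : List ℕ) : Measurable (branch r) := by
  induction r with
  | nil => exact measurable_id
  | cons a r ih => exact ih.comp (measurable_invBranch1 a)

lemma measurable_wave (s ξ : ℝ) (r : List ℕ) : Measurable (wave s ξ r) := by
  have := measurable_branch r
  have := (continuous_jac r).measurable
  unfold wave
  fun_prop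

/-- The term of the word `r` in the iterated transfer identity for `∫ f ∂μ`. -/
noncomputable def branchIntegral {E : Type*} [NormedAddCommGroup E] [NormedSpace ℝ E]
    (μ : Measure ℝ) (s : ℝ) (f : ℝ → E) (r : List ℕ) : E :=
  ∫ x, jac r x ^ (-2 * s) • f (branch r x) ∂μ

lemma branchIntegral_nil {E : Type*} [NormedAddCommGroup E] [NormedSpace ℝ E]
    (μ : Measure ℝ) (s : ℝ) (f : ℝ → E) : branchIntegral μ s f [] = ∫ x, f x ∂μ := by
  simp [branchIntegral, jac]

end ReversedWord

namespace IsConformal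

variable {A : Finset ℕ} {N : ℕ} {s : ℝ} {μ : Measure ℝ} (hμ : IsConformal A N s μ)
  (hA : ∀ a ∈ A, 1 ≤ a ∧ a ≤ N) {E : Type*} [NormedAddCommGroup E] [NormedSpace ℝ E]

include hμ in
lemma mem_unit : ∀ᵐ x ∂μ, 0 ≤ x ∧ x ≤ 1 := by
  filter_upwards [hμ.support] with x hx
  have : (0 : ℝ) ≤ 1 / (N + 2) := by positivity
  exact ⟨hx.1, by linarith [hx.2]⟩

include hμ

lemma integral_transfer {f : ℝ → E} (hf : StronglyMeasurable f) (hfi : Integrable f μ) :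
    ∫ x, f x ∂μ = ∑ a ∈ A, ∫ x, (x + a) ^ (-2 * s) • f (invBranch1 a x) ∂μ := by
  have hm : ∀ a : ℕ, Measurable fun x : ℝ => ENNReal.ofReal ((x + a) ^ (-2 * s)) := fun a => by
    fun_prop
  have hle : ∀ a ∈ A, (μ.withDensity fun x => ENNReal.ofReal ((x + a) ^ (-2 * s))).map
      (invBranch1 a) ≤ μ := by
    intro a ha
    conv_rhs => rw [hμ.transfer]
    exact Finset.single_le_sum (f := fun a : ℕ =>
      (μ.withDensity fun x => ENNReal.ofReal ((x + a) ^ (-2 * s))).map (invBranch1 a))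
      (fun _ _ => Measure.zero_le _) ha
  conv_lhs => rw [hμ.transfer]
  rw [integral_finsetSum_measure fun a ha => hfi.mono_measure (hle a ha)]
  refine Finset.sum_congr rfl fun a _ => ?_
  rw [integral_map (measurable_invBranch1 a).aemeasurable hf.aestronglyMeasurable,
    integral_withDensity_eq_integral_toReal_smul (hm a) (by simp)]
  refine integral_congr_ae ?_
  filter_upwards [hμ.mem_unit] with x hx
  have := hx.1
  rw [ENNReal.toReal_ofReal (by positivity)]

omit hμ in
lemma jac_rpow_le_one (hs : 0 ≤ s) {r : List ℕ} (hr : ∀ a ∈ r, 1 ≤ a) {x : ℝ} (hx : 0 ≤ x) :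
    0 ≤ jac r x ^ (-2 * s) ∧ jac r x ^ (-2 * s) ≤ 1 :=
  ⟨Real.rpow_nonneg (jac_pos hr hx).le _, Real.rpow_le_one_of_one_le_of_nonpos
    ((den_bounds hr).1.trans (den_le_jac hr hx)) (by linarith)⟩

lemma integrable_branch (hs : 0 ≤ s) {f : ℝ → E} (hf : StronglyMeasurable f) {C : ℝ}
    (hfC : ∀ x, ‖f x‖ ≤ C) {r : List ℕ} (hr : ∀ a ∈ r, 1 ≤ a) :
    Integrable (fun x => jac r x ^ (-2 * s) • f (branch r x)) μ := by
  have := hμ.prob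
  refine Integrable.of_bound (C := C) ?_ ?_
  · have := (continuous_jac r).measurable
    refine AEStronglyMeasurable.smul (Measurable.aestronglyMeasurable (by fun_prop)) ?_
    exact (hf.comp_measurable (measurable_branch r)).aestronglyMeasurable
  · filter_upwards [hμ.mem_unit] with x hx
    obtain ⟨h1, h2⟩ := jac_rpow_le_one hs hr hx.1
    rw [norm_smul, Real.norm_eq_abs, abs_of_nonneg h1]
    calc _ ≤ 1 * C := mul_le_mul h2 (hfC _) (norm_nonneg _) zero_le_one
      _ = C := one_mul C

include hA

lemma branchIntegral_eq_sum (hs : 0 ≤ s) {f : ℝ → E} (hf : StronglyMeasurable f) {C : ℝ}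
    (hfC : ∀ x, ‖f x‖ ≤ C) {r : List ℕ} (hr : ∀ a ∈ r, a ∈ A) :
    branchIntegral μ s f r = ∑ a ∈ A, branchIntegral μ s f (a :: r) := by
  have := (continuous_jac r).measurable
  have hr' : ∀ a ∈ r, 1 ≤ a := fun a ha => (hA a (hr a ha)).1
  rw [branchIntegral, hμ.integral_transfer _ (hμ.integrable_branch hs hf hfC hr')]
  · refine Finset.sum_congr rfl fun a ha => integral_congr_ae ?_
    filter_upwards [hμ.mem_unit] with x hx
    have ha' := (hA a ha).1
    have h1 := hx.1
    rw [jac_cons a ha' r hx.1, Real.mul_rpow (by positivity)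
      (jac_pos hr' (invBranch1_mem ha' hx.1).1).le, smul_smul, branch_cons]
  · exact (Measurable.stronglyMeasurable (by fun_prop)).smul
      (hf.comp_measurable (measurable_branch r))

lemma branchIntegral_one_bounds (hs : 0 ≤ s) (hs1 : s ≤ 1) {r : List ℕ} (hr : ∀ a ∈ r, a ∈ A) :
    size r ^ (-2 * s) ≤ branchIntegral μ s (fun _ => (1 : ℝ)) r ∧
      branchIntegral μ s (fun _ => (1 : ℝ)) r ≤ 4 * size r ^ (-2 * s) := by
  have := hμ.prob
  have hr' : ∀ a ∈ r, 1 ≤ a := fun a ha => (hA a (hr a ha)).1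
  have hi := hμ.integrable_branch hs (f := fun _ => (1 : ℝ)) stronglyMeasurable_const (C := 1)
    (by simp) hr'
  constructor
  · calc size r ^ (-2 * s) = ∫ _, size r ^ (-2 * s) ∂μ := by simp
      _ ≤ _ := by
        refine integral_mono_ae (integrable_const _) hi ?_
        filter_upwards [hμ.mem_unit] with x hx
        rw [smul_eq_mul, mul_one]
        exact Real.rpow_le_rpow_of_nonpos (jac_pos hr' hx.1) (jac_le_size hr' hx.2) (by linarith)
  · calc _ ≤ ∫ _, 4 * size r ^ (-2 * s) ∂μ := by
          refine integral_mono_ae hi (integrable_const _) ?_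
          filter_upwards [hμ.mem_unit] with x hx
          rw [smul_eq_mul, mul_one]
          exact jac_rpow_le hr' hs hs1 hx.1
      _ = _ := by simp

lemma isWeight (hs : 0 ≤ s) (hs1 : s ≤ 1) :
    IsWeight A s (branchIntegral μ s fun _ => (1 : ℝ)) where
  nil := by have := hμ.prob; simp [branchIntegral_nil]
  additive r hr := hμ.branchIntegral_eq_sum hA hs stronglyMeasurable_const (C := 1) (by simp) hr
  lower r hr := (hμ.branchIntegral_one_bounds hA hs hs1 hr).1

lemma muFourier_eq_sum (hs : 0 ≤ s) {Q : ℝ} (hQ : 0 < Q) {n : ℕ} (hn : Q ≤ (3 / 2) ^ n) (ξ : ℝ) :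
    muFourier μ ξ = ∑ r ∈ cutset A Q n, ∫ x, wave s ξ r x ∂μ := by
  have hfm : StronglyMeasurable fun x : ℝ => Complex.exp ((-(2 * π * ξ * x) : ℝ) * Complex.I) :=
    (by fun_prop : Continuous _).stronglyMeasurable
  have hf1 : ∀ x : ℝ, ‖Complex.exp ((-(2 * π * ξ * x) : ℝ) * Complex.I)‖ ≤ 1 := fun x =>
    (Complex.norm_exp_ofReal_mul_I _).le
  have h0 : muFourier μ ξ = branchIntegral μ s
      (fun x : ℝ => Complex.exp ((-(2 * π * ξ * x) : ℝ) * Complex.I)) [] := by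
    rw [branchIntegral_nil, muFourier]
    refine integral_congr_ae (Eventually.of_forall fun x => ?_)
    simp only [Complex.ofReal_neg]
  have h1 : ∀ r : List ℕ, (∀ a ∈ r, a ∈ A) → branchIntegral μ s
      (fun x : ℝ => Complex.exp ((-(2 * π * ξ * x) : ℝ) * Complex.I)) r = ∑ a ∈ A, branchIntegral μ s
      (fun x : ℝ => Complex.exp ((-(2 * π * ξ * x) : ℝ) * Complex.I)) (a :: r) :=
    fun r hr => hμ.branchIntegral_eq_sum hA hs hfm hf1 hr
  have h2 := sum_cutset_eq (A := A) (fun a ha => (hA a ha).1) hQ h1 hn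
  rw [h0, h2]
  refine Finset.sum_congr rfl fun r _ => ?_
  rw [branchIntegral]
  refine integral_congr_ae (Eventually.of_forall fun x => ?_)
  simp only [wave, Complex.real_smul]

set_option maxHeartbeats 1000000 in
/-- Upper regularity of conformal measures. -/
lemma measureReal_le (hs : 0 ≤ s) (hs1 : s ≤ 1) {h : ℝ} (hh : 0 < h) {I : Set ℝ}
    (hI : MeasurableSet I) (hIh : ∀ x ∈ I, ∀ y ∈ I, |x - y| ≤ h) :
    μ.real I ≤ 4 * (h * ((N + 2) * (N + 1) ^ 2)) ^ s := by
  have := hμ.prob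
  set B : ℝ := (N + 2) * (N + 1) ^ 2 with hB
  have hB0 : 0 < B := by positivity
  set f : ℝ → ℝ := I.indicator fun _ => 1 with hf
  have hfm : StronglyMeasurable f := stronglyMeasurable_const.indicator hI
  have hf1 : ∀ x, 0 ≤ f x ∧ f x ≤ 1 := fun x => by
    by_cases hx : x ∈ I <;> simp [hf, hx]
  have hfn : ∀ x, ‖f x‖ ≤ 1 := fun x => by
    rw [Real.norm_eq_abs, abs_of_nonneg (hf1 x).1]; exact (hf1 x).2
  have hA1 : ∀ {l : List ℕ}, (∀ a ∈ l, a ∈ A) → ∀ a ∈ l, 1 ≤ a := fun h a ha => (hA a (h a ha)).1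
  have hlarge : ∀ r : List ℕ, (∀ a ∈ r, a ∈ A) → 1 ≤ h * B * size r ^ 2 →
      branchIntegral μ s f r ≤ 4 * (h * B) ^ s := by
    intro r hr hbig
    have hr1 := one_le_size (hA1 hr)
    calc _ ≤ branchIntegral μ s (fun _ => (1 : ℝ)) r := by
          refine integral_mono_ae (hμ.integrable_branch hs hfm hfn (hA1 hr))
            (hμ.integrable_branch hs stronglyMeasurable_const (C := 1) (by simp) (hA1 hr)) ?_
          filter_upwards [hμ.mem_unit] with x hx
          exact smul_le_smul_of_nonneg_left (hf1 _).2 (jac_rpow_le_one hs (hA1 hr) hx.1).1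
      _ ≤ 4 * size r ^ (-2 * s) := (hμ.branchIntegral_one_bounds hA hs hs1 hr).2
      _ ≤ 4 * (h * B) ^ s := by
          gcongr
          rw [Real.rpow_mul (by positivity)]
          refine Real.rpow_le_rpow (by positivity) ?_ hs
          rw [Real.rpow_neg (by positivity), Real.rpow_two, inv_le_iff_one_le_mul₀ (by positivity)]
          exact hbig
  have hne : ∀ {r : List ℕ}, branchIntegral μ s f r ≠ 0 →
      ∃ x, (0 ≤ x ∧ x ≤ 1 - 1 / ((N : ℝ) + 2)) ∧ branch r x ∈ I := by
    intro r hr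
    by_contra! hcon
    refine hr (integral_eq_zero_of_ae ?_)
    filter_upwards [hμ.support] with x hx
    simp [hf, hcon x hx]
  obtain ⟨n, hn⟩ := pow_unbounded_of_one_lt (1 / (h * B)) (by norm_num : (1 : ℝ) < 3 / 2)
  have hind : ∀ k (r : List ℕ), (∀ a ∈ r, a ∈ A) → r.length + k = n →
      branchIntegral μ s f r ≤ 4 * (h * B) ^ s := by
    intro k
    induction k with
    | zero =>
      intro r hr hk
      refine hlarge r hr ?_
      have h1 := pow_length_le_size (hA1 hr)
      have h2 := one_le_size (hA1 hr)
      rw [← hk, add_zero] at hn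
      have h3 := hn.le.trans h1
      rw [div_le_iff₀ (by positivity)] at h3
      nlinarith
    | succ k ih =>
      intro r hr hk
      by_cases hbig : 1 ≤ h * B * size r ^ 2
      · exact hlarge r hr hbig
      push Not at hbig
      have hchild : ∀ a ∈ A, branchIntegral μ s f (a :: r) ≤ 4 * (h * B) ^ s := fun a ha =>
        ih (a :: r) (by simpa using ⟨ha, hr⟩) (by rw [List.length_cons]; omega)
      rw [hμ.branchIntegral_eq_sum hA hs hfm hfn hr]
      by_cases hall : ∀ a ∈ A, branchIntegral μ s f (a :: r) = 0
      · rw [Finset.sum_eq_zero hall]; positivity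
      push Not at hall
      obtain ⟨a, ha, ha0⟩ := hall
      rw [Finset.sum_eq_single_of_mem a ha]
      · exact hchild a ha
      intro b hb hba
      by_contra hb0
      obtain ⟨x, hx, hxI⟩ := hne ha0
      obtain ⟨y, hy, hyI⟩ := hne hb0
      have hdist := hIh _ hxI _ hyI
      obtain ⟨ha1, haN⟩ := hA a ha
      obtain ⟨hb1, hbN⟩ := hA b hb
      have hκ : (0 : ℝ) < 1 / (N + 2) := by positivity
      obtain ⟨p1, p2⟩ := invBranch1_mem ha1 hx.1
      obtain ⟨q1, q2⟩ := invBranch1_mem hb1 hy.1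
      rw [branch_cons, branch_cons, abs_branch_sub (hA1 hr) p1 q1,
        abs_invBranch1_sub ha1 hb1 hx.1 hy.1] at hdist
      have j1 := jac_pos (hA1 hr) p1
      have j2 := jac_pos (hA1 hr) q1
      have j3 := jac_le_size (hA1 hr) p2
      have j4 := jac_le_size (hA1 hr) q2
      have hs0 := one_le_size (hA1 hr)
      have ha2 : (1 : ℝ) ≤ a := by exact_mod_cast ha1
      have hb2 : (1 : ℝ) ≤ b := by exact_mod_cast hb1
      have ha3 : (a : ℝ) ≤ N := by exact_mod_cast haN
      have hb3 : (b : ℝ) ≤ N := by exact_mod_cast hbN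
      have hsep : 1 / ((N : ℝ) + 2) ≤ |x + a - (y + b)| := by
        rcases lt_or_gt_of_ne hba with hlt | hlt
        · have : (b : ℝ) + 1 ≤ a := by exact_mod_cast hlt
          refine le_trans ?_ (le_abs_self _)
          linarith [hx.1, hy.2]
        · have : (a : ℝ) + 1 ≤ b := by exact_mod_cast hlt
          refine le_trans ?_ (neg_le_abs _)
          linarith [hy.1, hx.2]
      have hxa : 0 < x + a := by linarith [hx.1]
      have hyb : 0 < y + b := by linarith [hy.1]
      have : 1 / ((N : ℝ) + 2) / ((N + 1) * (N + 1)) / (size r * size r) ≤ h := by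
        refine le_trans ?_ hdist
        have hxN : x + a ≤ N + 1 := by linarith [hx.2]
        have hyN : y + b ≤ N + 1 := by linarith [hy.2]
        gcongr
      rw [div_div, div_div, div_le_iff₀ (by positivity)] at this
      nlinarith
  have := hind n [] (by simp) (by simp)
  rwa [branchIntegral_nil, hf, integral_indicator_const _ hI, smul_eq_mul, mul_one] at this

end IsConformal

/-- The square of the average of a Lipschitz function against a regular measure is controlled by
its Lebesgue `L²` norm. -/
lemma sq_norm_integral_le_of_regular {μ : Measure ℝ} [IsProbabilityMeasure μ]
    (hμ : ∀ᵐ x ∂μ, 0 ≤ x ∧ x ≤ 1) {F : ℝ → ℂ} (hF : Measurable F) {D h M E : ℝ} (hD0 : 0 ≤ D)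
    (hD : ∀ x ∈ Icc (0 : ℝ) 2, ∀ y ∈ Icc (0 : ℝ) 2, ‖F y - F x‖ ≤ D * |y - x|)
    (hh : 0 < h) (hh1 : h ≤ 1) (hM : ∀ y, μ.real (Icc (y - h) y) ≤ M)
    (hE : ∫ x in 0..2, ‖F x‖ ^ 2 ≤ E) :
    ‖∫ x, F x ∂μ‖ ^ 2 ≤ 2 * M * E / h + 2 * (D * h) ^ 2 := by
  have hM0 : 0 ≤ M := measureReal_nonneg.trans (hM 0)
  have hb : ∀ x ∈ Icc (0 : ℝ) 2, ‖F x‖ ≤ ‖F 0‖ + D * 2 := by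
    intro x hx
    have h1 := hD 0 (by simp) x hx
    have h2 := norm_le_norm_add_norm_sub' (F x) (F 0)
    rw [sub_zero, abs_of_nonneg hx.1] at h1
    nlinarith [hx.2]
  have hb2 : ∀ x ∈ Icc (0 : ℝ) 2, ‖‖F x‖ ^ 2‖ ≤ (‖F 0‖ + D * 2) ^ 2 := by
    intro x hx
    rw [norm_pow, norm_norm]
    exact pow_le_pow_left₀ (norm_nonneg _) (hb x hx) 2
  have hFi : Integrable F μ := by
    refine Integrable.of_bound hF.aestronglyMeasurable (‖F 0‖ + D * 2) ?_
    filter_upwards [hμ] with x hx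
    exact hb x ⟨hx.1, by linarith [hx.2]⟩
  have hF2i : Integrable (fun x => ‖F x‖ ^ 2) μ := by
    refine Integrable.of_bound (hF.norm.pow_const 2).aestronglyMeasurable
      ((‖F 0‖ + D * 2) ^ 2) ?_
    filter_upwards [hμ] with x hx
    exact hb2 x ⟨hx.1, by linarith [hx.2]⟩
  have hF2v : IntegrableOn (fun x => ‖F x‖ ^ 2) (Icc 0 2) := by
    refine Integrable.of_bound (hF.norm.pow_const 2).aestronglyMeasurable
      ((‖F 0‖ + D * 2) ^ 2) ?_
    filter_upwards [ae_restrict_mem measurableSet_Icc] with x hx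
    exact hb2 x hx
  have hE0 : 0 ≤ E := le_trans (intervalIntegral.integral_nonneg (by norm_num)
    fun x _ => by positivity) hE
  have hjensen : ‖∫ x, F x ∂μ‖ ^ 2 ≤ ∫ x, ‖F x‖ ^ 2 ∂μ := by
    set t := ‖∫ x, F x ∂μ‖ with ht
    have h1 : t ≤ ∫ x, ‖F x‖ ∂μ := norm_integral_le_integral_norm _
    have h2 : ∫ x, 2 * t * ‖F x‖ ∂μ ≤ ∫ x, (t ^ 2 + ‖F x‖ ^ 2) ∂μ :=
      integral_mono (hFi.norm.const_mul _) ((integrable_const _).add hF2i)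
        fun x => by simp only; nlinarith [sq_nonneg (t - ‖F x‖)]
    rw [integral_const_mul, integral_add (integrable_const _) hF2i] at h2
    simp only [integral_const, probReal_univ, one_smul] at h2
    nlinarith [norm_nonneg (∫ x, F x ∂μ)]
  set g : ℝ → ℝ≥0∞ := fun x => ENNReal.ofReal (‖F x‖ ^ 2) with hg
  have hgm : Measurable g := by fun_prop
  set S : Set (ℝ × ℝ) := {p | p.2 - h ≤ p.1 ∧ p.1 ≤ p.2} with hS
  have hSm : MeasurableSet S :=
    (measurableSet_le (measurable_snd.sub_const h) measurable_fst).inter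
      (measurableSet_le measurable_fst measurable_snd)
  set K : ℝ → ℝ → ℝ≥0∞ := fun x y => S.indicator (fun p => g p.2) (x, y) with hK
  have hKm : Measurable (Function.uncurry K) := (hgm.comp measurable_snd).indicator hSm
  have hpt : ∀ᵐ x ∂μ, g x * ENNReal.ofReal h ≤
      2 * (∫⁻ y in Icc 0 2, K x y) + ENNReal.ofReal (2 * (D * h) ^ 2) * ENNReal.ofReal h := by
    filter_upwards [hμ] with x hx
    have hvol : volume (Icc x (x + h)) = ENNReal.ofReal h := by rw [Real.volume_Icc]; congr 1; ring
    calc g x * ENNReal.ofReal h = ∫⁻ _ in Icc x (x + h), g x := by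
          rw [setLIntegral_const, hvol]
      _ ≤ ∫⁻ y in Icc x (x + h), (2 * K x y + ENNReal.ofReal (2 * (D * h) ^ 2)) := by
          refine setLIntegral_mono' measurableSet_Icc fun y hy => ?_
          have hmem : (x, y) ∈ S := ⟨by simp only; linarith [hy.2], hy.1⟩
          simp only [hK, indicator_of_mem hmem, hg]
          rw [show (2 : ℝ≥0∞) = ENNReal.ofReal 2 by simp, ← ENNReal.ofReal_mul (by norm_num),
            ← ENNReal.ofReal_add (by positivity) (by positivity)]
          refine ENNReal.ofReal_le_ofReal ?_
          have h1 := hD y ⟨by linarith [hy.1], by linarith [hy.2]⟩ x ⟨hx.1, by linarith⟩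
          have h2 : |x - y| ≤ h := by rw [abs_le]; constructor <;> linarith [hy.1, hy.2]
          have h3 := norm_le_norm_add_norm_sub' (F x) (F y)
          have h4 : ‖F x‖ ≤ ‖F y‖ + D * h := by nlinarith
          calc ‖F x‖ ^ 2 ≤ (‖F y‖ + D * h) ^ 2 := pow_le_pow_left₀ (norm_nonneg _) h4 2
            _ ≤ _ := by nlinarith [sq_nonneg (‖F y‖ - D * h)]
      _ = 2 * (∫⁻ y in Icc x (x + h), K x y) +
          ENNReal.ofReal (2 * (D * h) ^ 2) * ENNReal.ofReal h := by
          rw [lintegral_add_right _ measurable_const, setLIntegral_const, hvol,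
            lintegral_const_mul _ (show Measurable (K x) from hKm.comp measurable_prodMk_left)]
      _ ≤ _ := by
          gcongr
          · exact hx.1
          · linarith
  have hint : (∫⁻ x, g x ∂μ) * ENNReal.ofReal h ≤ 2 * (ENNReal.ofReal M * ENNReal.ofReal E) +
      ENNReal.ofReal (2 * (D * h) ^ 2) * ENNReal.ofReal h := by
    rw [← lintegral_mul_const _ hgm]
    refine (lintegral_mono_ae hpt).trans ?_
    rw [lintegral_add_right _ measurable_const, lintegral_const, measure_univ, mul_one,
      lintegral_const_mul _ hKm.lintegral_prod_right, lintegral_lintegral_swap hKm.aemeasurable]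
    gcongr
    calc ∫⁻ y in Icc 0 2, ∫⁻ x, K x y ∂μ ≤ ∫⁻ y in Icc 0 2, ENNReal.ofReal M * g y := by
          refine lintegral_mono fun y => ?_
          have : ∀ x, K x y = (Icc (y - h) y).indicator (fun _ => g y) x := fun x => rfl
          simp only [this]
          rw [lintegral_indicator_const measurableSet_Icc, mul_comm]
          gcongr
          rw [← ofReal_measureReal]
          exact ENNReal.ofReal_le_ofReal (hM y)
      _ = ENNReal.ofReal M * ∫⁻ y in Icc 0 2, g y := lintegral_const_mul _ hgm
      _ ≤ _ := by
          gcongr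
          rw [← ofReal_integral_eq_lintegral_ofReal hF2v
            (Eventually.of_forall fun x => by positivity)]
          refine ENNReal.ofReal_le_ofReal ?_
          rwa [integral_Icc_eq_integral_Ioc, ← intervalIntegral.integral_of_le (by norm_num)]
  rw [← ofReal_integral_eq_lintegral_ofReal hF2i (Eventually.of_forall fun x => by positivity),
    show (2 : ℝ≥0∞) = ENNReal.ofReal 2 by simp, ← ENNReal.ofReal_mul hM0,
    ← ENNReal.ofReal_mul zero_le_two, ← ENNReal.ofReal_mul (by positivity),
    ← ENNReal.ofReal_mul (by positivity),
    ← ENNReal.ofReal_add (by positivity) (by positivity),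
    ENNReal.ofReal_le_ofReal_iff (by positivity)] at hint
  refine hjensen.trans ?_
  rw [← sub_le_iff_le_add, le_div_iff₀ hh]
  linarith

namespace IsConformal

open ReversedWord

/-- Fourier transforms of conformal measures of exponent larger than `1 / 2` decay polynomially. -/
theorem norm_muFourier_le {A : Finset ℕ} {N : ℕ} {s : ℝ} {μ : Measure ℝ}
    (hμ : IsConformal A N s μ) (hA : ∀ a ∈ A, 1 ≤ a ∧ a ≤ N) (hN : 1 ≤ N) (hs : 1 / 2 < s)
    (hs1 : s ≤ 1) :
    ∃ K : ℝ, ∀ ξ : ℝ, 1 ≤ |ξ| → ‖muFourier μ ξ‖ ≤ K * |ξ| ^ (-((s - 1 / 2) / 8)) := by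
  have := hμ.prob
  have hs0 : 0 ≤ s := by linarith
  obtain ⟨J, hJ⟩ := pow_unbounded_of_one_lt (2 * (N + 1) : ℝ) (by norm_num : (1 : ℝ) < 3 / 2)
  set ε := s - 1 / 2 with hε
  have hε0 : 0 < ε := by linarith
  set B : ℝ := ((N : ℝ) + 2) * (N + 1) ^ 2 with hB
  set C : ℝ := 2 * (4 * B ^ s) * |energyConst N J s| + 2 * 136 ^ 2 with hC
  have hC0 : 0 ≤ C := by positivity
  refine ⟨2 * √C, fun ξ hξ => ?_⟩
  set Q : ℝ := |ξ| ^ (1 / 4 : ℝ) with hQ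
  have hQ1 : 1 ≤ Q := Real.one_le_rpow hξ (by norm_num)
  have hQ0 : 0 < Q := by linarith
  have hξQ : |ξ| = Q ^ 4 := by
    rw [hQ, ← Real.rpow_natCast, ← Real.rpow_mul (abs_nonneg _)]
    norm_num
  obtain ⟨n, hn⟩ := pow_unbounded_of_one_lt Q (by norm_num : (1 : ℝ) < 3 / 2)
  have hW := hμ.isWeight hA hs0 hs1
  set h : ℝ := Q ^ (-2 - 2 * ε) with hh
  have hh0 : 0 < h := Real.rpow_pos_of_pos hQ0 _
  have hh1 : h ≤ 1 := Real.rpow_le_one_of_one_le_of_nonpos hQ1 (by linarith)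
  have hpar : ∀ S ⊆ cutset A Q n, ∀ τ : ℝ, (∀ r ∈ S, (-1 : ℝ) ^ r.length = τ) →
      ‖∫ x, ∑ r ∈ S, wave s ξ r x ∂μ‖ ≤ √C * Q ^ (-ε / 2) := by
    intro S hS τ hτ
    have hreg : ∀ y, μ.real (Icc (y - h) y) ≤ 4 * (h * B) ^ s := fun y =>
      hμ.measureReal_le hA hs0 hs1 hh0 measurableSet_Icc fun u hu v hv => by
        rw [abs_le]; constructor <;> linarith [hu.1, hu.2, hv.1, hv.2]
    have h1 := sq_norm_integral_le_of_regular hμ.mem_unit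
      (Finset.measurable_sum S fun r _ => measurable_wave s ξ r) (D := 136 * Q ^ 2)
      (by positivity)
      (fun x hx y hy => norm_sum_wave_sub_le hW hA hs0 hs1 hQ1 hξQ hS hx hy)
      hh0 hh1 hreg ((integral_sq_sum_wave_le hW hA hN hs hs1 hJ.le hQ1 hξQ hS hτ).trans
        (div_le_div_of_nonneg_right (le_abs_self _) hQ0.le))
    have e1 : h ^ s / h / Q ≤ Q ^ (-ε) := by
      rw [hh, ← Real.rpow_mul hQ0.le, ← Real.rpow_sub hQ0, ← Real.rpow_sub_one hQ0.ne']
      refine Real.rpow_le_rpow_of_exponent_le hQ1 ?_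
      rw [hε]
      nlinarith
    have e2 : (Q ^ 2 * h) ^ 2 ≤ Q ^ (-ε) := by
      rw [hh, ← Real.rpow_natCast Q 2, ← Real.rpow_add hQ0, ← Real.rpow_natCast,
        ← Real.rpow_mul hQ0.le]
      refine Real.rpow_le_rpow_of_exponent_le hQ1 ?_
      push_cast
      linarith
    have h2 : ‖∫ x, ∑ r ∈ S, wave s ξ r x ∂μ‖ ^ 2 ≤ C * Q ^ (-ε) := by
      refine h1.trans ?_
      rw [Real.mul_rpow hh0.le (by positivity)]
      calc _ = 2 * (4 * B ^ s) * |energyConst N J s| * (h ^ s / h / Q)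
            + 2 * 136 ^ 2 * (Q ^ 2 * h) ^ 2 := by field_simp
        _ ≤ 2 * (4 * B ^ s) * |energyConst N J s| * Q ^ (-ε) + 2 * 136 ^ 2 * Q ^ (-ε) := by
            gcongr
        _ = C * Q ^ (-ε) := by rw [hC]; ring
    refine le_of_sq_le_sq ?_ (by positivity)
    rw [mul_pow, Real.sq_sqrt hC0, ← Real.rpow_mul_natCast hQ0.le]
    rwa [show -ε / 2 * ((2 : ℕ) : ℝ) = -ε by push_cast; ring]
  have hint : ∀ r ∈ cutset A Q n, Integrable (wave s ξ r) μ := by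
    intro r hr
    have hr' : ∀ a ∈ r, 1 ≤ a := fun a ha => (hA a ((mem_cutset.1 hr).1.2 a ha)).1
    refine Integrable.of_bound (measurable_wave s ξ r).aestronglyMeasurable 1 ?_
    filter_upwards [hμ.mem_unit] with x hx
    rw [norm_wave hr' hx.1]
    exact (jac_rpow_le_one hs0 hr' hx.1).2
  rw [hμ.muFourier_eq_sum hA hs0 hQ0 hn.le ξ,
    ← Finset.sum_filter_add_sum_filter_not (cutset A Q n) (fun r => Even r.length),
    ← integral_finsetSum _ fun r hr => hint r (Finset.filter_subset _ _ hr),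
    ← integral_finsetSum _ fun r hr => hint r (Finset.filter_subset _ _ hr)]
  have k1 := hpar ((cutset A Q n).filter fun r => Even r.length) (Finset.filter_subset _ _) 1
    fun r hr => (Finset.mem_filter.1 hr).2.neg_one_pow
  have k2 := hpar ((cutset A Q n).filter fun r => ¬ Even r.length) (Finset.filter_subset _ _) (-1)
    fun r hr => (Nat.not_even_iff_odd.1 (Finset.mem_filter.1 hr).2).neg_one_pow
  refine (norm_add_le _ _).trans ((add_le_add k1 k2).trans (le_of_eq ?_))
  rw [hQ, ← Real.rpow_mul (abs_nonneg _)]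
  rw [show (1 / 4 : ℝ) * (-ε / 2) = -(ε / 8) by ring]
  ring

end IsConformal

open ReversedWord

/-- The inverse branch `T_a` as a measurable bijection of `ℝ`, using `0⁻¹ = 0`. -/
noncomputable def invBranchEquiv (a : ℕ) : ℝ ≃ᵐ ℝ :=
  (MeasurableEquiv.addRight (a : ℝ)).trans (MeasurableEquiv.inv ℝ)

lemma coe_invBranchEquiv (a : ℕ) : ⇑(invBranchEquiv a) = invBranch1 a := rfl

lemma measure_le_mul_of_partition {m ν : Measure ℝ} {P : ℕ → Set ℝ}
    (hP : ∀ k, MeasurableSet (P k)) (hd : Pairwise (Function.onFun Disjoint P))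
    (hU : ⋃ k, P k = univ) {G : Set ℝ} (hG : MeasurableSet G) {ρ : ℝ≥0∞}
    (h : ∀ k, ν (G ∩ P k) ≤ ρ * m (G ∩ P k)) : ν G ≤ ρ * m G := by
  have hGU : G = ⋃ k, G ∩ P k := by rw [← inter_iUnion, hU, inter_univ]
  calc ν G = ν (⋃ k, G ∩ P k) := by rw [← hGU]
    _ ≤ ∑' k, ν (G ∩ P k) := measure_iUnion_le _
    _ ≤ ∑' k, ρ * m (G ∩ P k) := ENNReal.tsum_le_tsum h
    _ = ρ * m (⋃ k, G ∩ P k) := by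
        rw [ENNReal.tsum_mul_left, measure_iUnion
          (fun i j hij => (hd hij).mono inter_subset_right inter_subset_right)
          fun k => hG.inter (hP k)]
    _ = ρ * m G := by rw [← hGU]

lemma lipschitzOnWith_invBranch1 {a : ℕ} (ha : 1 ≤ a) {u : ℝ} (hu : 0 ≤ u) {G : Set ℝ}
    (hG : ∀ x ∈ G, u ≤ x) : LipschitzOnWith (Real.toNNReal ((u + a) ^ (-2 : ℝ))) (invBranch1 a) G := by
  have ha' : (1 : ℝ) ≤ a := by exact_mod_cast ha
  refine LipschitzOnWith.of_dist_le_mul fun x hx y hy => ?_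
  have h1 := hG x hx
  have h2 := hG y hy
  rw [Real.coe_toNNReal _ (by positivity), Real.dist_eq, Real.dist_eq,
    abs_invBranch1_sub ha ha (hu.trans h1) (hu.trans h2), Real.rpow_neg (by positivity),
    Real.rpow_two, add_sub_add_right_eq_sub, div_eq_inv_mul]
  have := hu.trans h1
  gcongr
  rw [sq]
  gcongr

lemma lipschitzOnWith_invBranch1_symm {a : ℕ} (ha : 1 ≤ a) {v : ℝ} {G : Set ℝ}
    (hG : ∀ x ∈ G, 0 ≤ x ∧ x ≤ v) :
    LipschitzOnWith (Real.toNNReal ((v + a) ^ (2 : ℝ))) (invBranchEquiv a).symm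
      (invBranch1 a '' G) := by
  have ha' : (1 : ℝ) ≤ a := by exact_mod_cast ha
  refine LipschitzOnWith.of_dist_le_mul ?_
  rintro _ ⟨x, hx, rfl⟩ _ ⟨y, hy, rfl⟩
  obtain ⟨hx0, hxv⟩ := hG x hx
  obtain ⟨hy0, hyv⟩ := hG y hy
  have hv := hx0.trans hxv
  rw [Real.coe_toNNReal _ (by positivity), ← coe_invBranchEquiv, MeasurableEquiv.symm_apply_apply,
    MeasurableEquiv.symm_apply_apply, coe_invBranchEquiv, Real.dist_eq, Real.dist_eq,
    abs_invBranch1_sub ha ha hx0 hy0, Real.rpow_two, add_sub_add_right_eq_sub, mul_div_assoc',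
    le_div_iff₀ (by positivity), mul_comm]
  gcongr
  rw [sq]
  gcongr

lemma rpow_distortion {a : ℕ} (ha : 1 ≤ a) {s u v δ : ℝ} (hs : 0 ≤ s) (hu : 0 ≤ u) (hv : 0 ≤ v)
    (hδ : 0 ≤ δ) (huv : v ≤ u + δ) :
    ENNReal.ofReal ((u + a) ^ (-2 * s)) * ENNReal.ofReal ((v + a) ^ (2 * s)) ≤
      ENNReal.ofReal ((1 + δ) ^ (2 * s)) := by
  have ha' : (1 : ℝ) ≤ a := by exact_mod_cast ha
  rw [← ENNReal.ofReal_mul (by positivity)]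
  refine ENNReal.ofReal_le_ofReal ?_
  rw [show -2 * s = -(2 * s) by ring, Real.rpow_neg (by positivity), ← div_eq_inv_mul,
    ← Real.div_rpow (by positivity) (by positivity)]
  refine Real.rpow_le_rpow (by positivity) ?_ (by positivity)
  rw [div_le_iff₀ (by positivity)]
  nlinarith

section Piece

variable {a : ℕ} (ha : 1 ≤ a) {s u v δ : ℝ} (hs : 0 ≤ s) (hu : 0 ≤ u) (hδ : 0 ≤ δ)
  (huv : v ≤ u + δ) {G : Set ℝ} (hG : MeasurableSet G) (hGuv : ∀ x ∈ G, u ≤ x ∧ x ≤ v)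
include ha hs hu hδ huv hG hGuv

lemma hausdorffMeasure_image_le_of_piece :
    μH[s] (invBranch1 a '' G) ≤ ENNReal.ofReal ((1 + δ) ^ (2 * s)) *
      ∫⁻ x in G, ENNReal.ofReal ((x + a) ^ (-2 * s)) ∂μH[s] := by
  rcases G.eq_empty_or_nonempty with rfl | ⟨x₀, hx₀⟩
  · simp
  have ha' : (1 : ℝ) ≤ a := by exact_mod_cast ha
  have hv : 0 ≤ v := hu.trans ((hGuv x₀ hx₀).1.trans (hGuv x₀ hx₀).2)
  have h1 := (lipschitzOnWith_invBranch1 ha hu fun x hx => (hGuv x hx).1).hausdorffMeasure_image_le hs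
  have hVW : ENNReal.ofReal ((v + a) ^ (2 * s)) * ENNReal.ofReal ((v + a) ^ (-2 * s)) = 1 := by
    rw [← ENNReal.ofReal_mul (by positivity), ← Real.rpow_add (by positivity)]
    simp
  calc _ ≤ _ := h1
    _ = ENNReal.ofReal ((u + a) ^ (-2 * s)) * (ENNReal.ofReal ((v + a) ^ (2 * s)) *
          ENNReal.ofReal ((v + a) ^ (-2 * s))) * μH[s] G := by
        rw [hVW, mul_one, Real.rpow_mul (by positivity),
          ← ENNReal.ofReal_rpow_of_nonneg (by positivity) hs]
        rfl
    _ = ENNReal.ofReal ((u + a) ^ (-2 * s)) * ENNReal.ofReal ((v + a) ^ (2 * s)) *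
          (ENNReal.ofReal ((v + a) ^ (-2 * s)) * μH[s] G) := by ring
    _ ≤ _ := by
        refine mul_le_mul' (rpow_distortion ha hs hu hv hδ huv) ?_
        rw [← setLIntegral_const]
        refine setLIntegral_mono' hG fun x hx => ENNReal.ofReal_le_ofReal ?_
        obtain ⟨h2, h3⟩ := hGuv x hx
        have := hu.trans h2
        exact Real.rpow_le_rpow_of_nonpos (by positivity) (by linarith) (by linarith)

lemma lintegral_le_of_piece :
    ∫⁻ x in G, ENNReal.ofReal ((x + a) ^ (-2 * s)) ∂μH[s] ≤
      ENNReal.ofReal ((1 + δ) ^ (2 * s)) * μH[s] (invBranch1 a '' G) := by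
  rcases G.eq_empty_or_nonempty with rfl | ⟨x₀, hx₀⟩
  · simp
  have ha' : (1 : ℝ) ≤ a := by exact_mod_cast ha
  have hv : 0 ≤ v := hu.trans ((hGuv x₀ hx₀).1.trans (hGuv x₀ hx₀).2)
  have h1 := (lipschitzOnWith_invBranch1_symm ha
    fun x hx => ⟨hu.trans (hGuv x hx).1, (hGuv x hx).2⟩).hausdorffMeasure_image_le hs
  have himg : (invBranchEquiv a).symm '' (invBranch1 a '' G) = G := by
    rw [← coe_invBranchEquiv, image_image]
    simp
  rw [himg] at h1
  calc _ ≤ ∫⁻ _ in G, ENNReal.ofReal ((u + a) ^ (-2 * s)) ∂μH[s] := by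
        refine setLIntegral_mono' hG fun x hx => ENNReal.ofReal_le_ofReal ?_
        exact Real.rpow_le_rpow_of_nonpos (by positivity) (by linarith [(hGuv x hx).1])
          (by linarith)
    _ = ENNReal.ofReal ((u + a) ^ (-2 * s)) * μH[s] G := setLIntegral_const _ _
    _ ≤ ENNReal.ofReal ((u + a) ^ (-2 * s)) * (ENNReal.ofReal ((v + a) ^ (2 * s)) *
          μH[s] (invBranch1 a '' G)) := by
        gcongr
        rw [Real.rpow_mul (by positivity), ← ENNReal.ofReal_rpow_of_nonneg (by positivity) hs]
        exact h1
    _ ≤ _ := by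
        rw [← mul_assoc]
        gcongr
        exact rpow_distortion ha hs hu hv hδ huv

end Piece

/-- The change of variables formula for the Hausdorff measure under an inverse branch. -/
lemma hausdorffMeasure_image_invBranch1 {a : ℕ} (ha : 1 ≤ a) {s : ℝ} (hs : 0 ≤ s) {G : Set ℝ}
    (hG : MeasurableSet G) (hG0 : ∀ x ∈ G, 0 ≤ x) :
    μH[s] (invBranch1 a '' G) = ∫⁻ x in G, ENNReal.ofReal ((x + a) ^ (-2 * s)) ∂μH[s] := by
  set ν : Measure ℝ := (μH[s]).map (invBranchEquiv a).symm with hν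
  set m : Measure ℝ := (μH[s]).withDensity fun x => ENNReal.ofReal ((x + a) ^ (-2 * s)) with hm
  have hνap : ∀ E : Set ℝ, ν E = μH[s] (invBranch1 a '' E) := fun E => by
    rw [hν, MeasurableEquiv.map_apply, ← MeasurableEquiv.image_eq_preimage_symm, coe_invBranchEquiv]
  have hmap : ∀ E : Set ℝ, MeasurableSet E →
      m E = ∫⁻ x in E, ENNReal.ofReal ((x + a) ^ (-2 * s)) ∂μH[s] := fun E hE =>
    withDensity_apply _ hE
  set ρ : ℕ → ℝ≥0∞ := fun n => ENNReal.ofReal ((1 + 1 / ((n : ℝ) + 1)) ^ (2 * s)) with hρ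
  have hρ1 : Tendsto ρ atTop (𝓝 1) := by
    have h1 : Tendsto (fun n : ℕ => (1 + 1 / ((n : ℝ) + 1)) ^ (2 * s)) atTop (𝓝 1) := by
      have := (tendsto_one_div_add_atTop_nhds_zero_nat (𝕜 := ℝ)).const_add 1
      rw [add_zero] at this
      simpa using this.rpow_const (p := 2 * s) (Or.inl one_ne_zero)
    rw [← ENNReal.ofReal_one]
    exact ENNReal.tendsto_ofReal h1
  have hkey : ∀ n, ν G ≤ ρ n * m G ∧ m G ≤ ρ n * ν G := by
    intro n
    have hn : (0 : ℝ) < n + 1 := by positivity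
    set P : ℕ → Set ℝ := fun k => {x | ⌊((n : ℝ) + 1) * x⌋₊ = k} with hPdef
    have hP : ∀ k, MeasurableSet (P k) := fun k =>
      (Nat.measurable_floor.comp (measurable_const_mul ((n : ℝ) + 1))) (measurableSet_singleton k)
    have hd : Pairwise (Function.onFun Disjoint P) := fun i j hij =>
      disjoint_left.2 fun x (hi : _ = i) (hj : _ = j) => hij (hi.symm.trans hj)
    have hU : ⋃ k, P k = univ := eq_univ_of_forall fun x => mem_iUnion.2 ⟨_, rfl⟩
    have hpiece : ∀ k, ∀ x ∈ G ∩ P k,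
        (k : ℝ) / (n + 1) ≤ x ∧ x ≤ (k : ℝ) / (n + 1) + 1 / (n + 1) := by
      rintro k x ⟨hx, hk⟩
      have hx0 := hG0 x hx
      rw [← add_div, div_le_iff₀ hn, le_div_iff₀ hn, mul_comm x]
      have hk' : ⌊((n : ℝ) + 1) * x⌋₊ = k := hk
      rw [← hk']
      exact ⟨Nat.floor_le (by positivity), (Nat.lt_floor_add_one _).le⟩
    refine ⟨measure_le_mul_of_partition hP hd hU hG fun k => ?_,
      measure_le_mul_of_partition hP hd hU hG fun k => ?_⟩
    · rw [hνap, hmap _ (hG.inter (hP k))]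
      exact hausdorffMeasure_image_le_of_piece ha hs (by positivity) (by positivity) le_rfl
        (hG.inter (hP k)) (hpiece k)
    · rw [hνap, hmap _ (hG.inter (hP k))]
      exact lintegral_le_of_piece ha hs (by positivity) (by positivity) le_rfl
        (hG.inter (hP k)) (hpiece k)
  rw [← hνap, ← hmap _ hG]
  have hlim : ∀ c, Tendsto (fun n => ρ n * c) atTop (𝓝 c) := fun c => by
    simpa using ENNReal.Tendsto.mul_const hρ1 (Or.inl one_ne_zero)
  exact le_antisymm (ge_of_tendsto' (hlim _) fun n => (hkey n).1)
    (ge_of_tendsto' (hlim _) fun n => (hkey n).2)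

section Digits

lemma gaussSet_pos {x : ℝ} (hx : x ∈ gaussSet) : 0 < x ∧ x < 1 :=
  ⟨lt_of_le_of_ne hx.1.1 fun h => hx.2.ne_nat 0 (by simp [← h]),
    lt_of_le_of_ne hx.1.2 fun h => hx.2.ne_nat 1 (by simp [h])⟩

lemma one_le_inv_of_mem_gaussSet {x : ℝ} (hx : x ∈ gaussSet) : 1 ≤ x⁻¹ :=
  (one_le_inv₀ (gaussSet_pos hx).1).2 (gaussSet_pos hx).2.le

lemma inv_eq_gaussMap_add {x : ℝ} (hx : x ∈ gaussSet) : x⁻¹ = gaussMap x + cfDigit1 x := by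
  have := one_le_inv_of_mem_gaussSet hx
  rw [gaussMap, cfDigit1, natCast_floor_eq_intCast_floor (by linarith), Int.fract_add_floor]

lemma invBranch1_cfDigit1 {x : ℝ} (hx : x ∈ gaussSet) :
    invBranch1 (cfDigit1 x) (gaussMap x) = x := by
  rw [invBranch1, ← inv_eq_gaussMap_add hx, inv_inv]

lemma gaussMap_mem {x : ℝ} (hx : x ∈ gaussSet) : gaussMap x ∈ gaussSet := by
  refine ⟨⟨Int.fract_nonneg _, (Int.fract_lt_one _).le⟩, ?_⟩
  have h := irrational_inv_iff.2 hx.2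
  rw [inv_eq_gaussMap_add hx] at h
  exact h.of_add_natCast _

variable {a : ℕ} (ha : 1 ≤ a) {y : ℝ} (hy : y ∈ gaussSet)
include ha hy

lemma invBranch1_mem_gaussSet : invBranch1 a y ∈ gaussSet := by
  obtain ⟨h1, h2⟩ := ReversedWord.invBranch1_mem ha (gaussSet_pos hy).1.le
  exact ⟨⟨h1, h2⟩, irrational_inv_iff.2 (hy.2.add_natCast a)⟩

omit ha in
lemma cfDigit1_invBranch1 : cfDigit1 (invBranch1 a y) = a := by
  obtain ⟨h1, h2⟩ := gaussSet_pos hy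
  rw [cfDigit1, invBranch1, inv_inv, Nat.floor_add_natCast h1.le, Nat.floor_eq_zero.2 h2, zero_add]

omit ha in
lemma gaussMap_invBranch1 : gaussMap (invBranch1 a y) = y := by
  obtain ⟨h1, h2⟩ := gaussSet_pos hy
  rw [gaussMap, invBranch1, inv_inv, Int.fract_add_natCast, Int.fract_eq_self.2 ⟨h1.le, h2⟩]

end Digits

lemma mem_badSet_iff {A : Finset ℕ} {x : ℝ} (hx : x ∈ gaussSet) :
    x ∈ badSet A ↔ cfDigit1 x ∈ A ∧ gaussMap x ∈ badSet A := by
  refine ⟨fun h => ⟨h.2 0, gaussMap_mem hx, fun i => ?_⟩, fun h => ⟨hx, fun i => ?_⟩⟩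
  · have := h.2 (i + 1)
    rwa [cfDigit, Function.iterate_succ_apply] at this
  · cases i with
    | zero => exact h.1
    | succ i =>
      have := h.2.2 i
      rwa [cfDigit, Function.iterate_succ_apply]

lemma measurable_gaussMap : Measurable gaussMap := measurable_inv.fract

lemma measurable_cfDigit1 : Measurable cfDigit1 := Nat.measurable_floor.comp measurable_inv

lemma measurableSet_badSet (A : Finset ℕ) : MeasurableSet (badSet A) := by
  have h : badSet A = gaussSet ∩ ⋂ i, cfDigit i ⁻¹' (A : Set ℕ) := by
    ext x; simp [badSet]
  rw [h]
  refine MeasurableSet.inter (measurableSet_Icc.inter IsGδ.setOfPred_irrational.measurableSet)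
    (MeasurableSet.iInter fun i => ?_)
  exact (measurable_cfDigit1.comp (measurable_gaussMap.iterate i)) A.measurableSet

lemma badSet_bounds {A : Finset ℕ} {N : ℕ} (hA : ∀ a ∈ A, 1 ≤ a ∧ a ≤ N) {x : ℝ}
    (hx : x ∈ badSet A) : 0 ≤ x ∧ x ≤ 1 - 1 / ((N : ℝ) + 2) := by
  have hlow : ∀ y ∈ badSet A, 1 / ((N : ℝ) + 1) ≤ y := fun y hy => by
    have h1 := gaussSet_pos hy.1
    have h2 := gaussSet_pos (gaussMap_mem hy.1)
    have h3 : (cfDigit1 y : ℝ) ≤ N := by exact_mod_cast (hA _ ((mem_badSet_iff hy.1).1 hy).1).2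
    rw [one_div, inv_le_comm₀ (by positivity) h1.1, inv_eq_gaussMap_add hy.1]
    linarith
  have h1 := gaussSet_pos hx.1
  have h2 := hlow _ ((mem_badSet_iff hx.1).1 hx).2
  have h3 : (1 : ℝ) ≤ cfDigit1 x := by
    exact_mod_cast (hA _ ((mem_badSet_iff hx.1).1 hx).1).1
  refine ⟨h1.1.le, ?_⟩
  have h4 : (1 - 1 / ((N : ℝ) + 2)) = (1 + 1 / ((N : ℝ) + 1))⁻¹ := by field_simp; ring
  rw [h4, le_inv_comm₀ h1.1 (by positivity), inv_eq_gaussMap_add hx.1]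
  linarith

/-- Decomposition of the Hausdorff measure on `B(𝒜)` along the first digit. -/
lemma hausdorffMeasure_inter_badSet {A : Finset ℕ} (hA : ∀ a ∈ A, 1 ≤ a) {s : ℝ} (hs : 0 ≤ s)
    {E : Set ℝ} (hE : MeasurableSet E) :
    μH[s] (E ∩ badSet A) = ∑ a ∈ A, ∫⁻ x in invBranch1 a ⁻¹' E ∩ badSet A,
      ENNReal.ofReal ((x + a) ^ (-2 * s)) ∂μH[s] := by
  have hB := measurableSet_badSet A
  have hdec : E ∩ badSet A = ⋃ a ∈ A, invBranch1 a '' (invBranch1 a ⁻¹' E ∩ badSet A) := by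
    ext x
    simp only [mem_iUnion, mem_image, mem_inter_iff, mem_preimage, exists_prop]
    constructor
    · rintro ⟨hxE, hx⟩
      obtain ⟨h1, h2⟩ := (mem_badSet_iff hx.1).1 hx
      have h3 := invBranch1_cfDigit1 hx.1
      exact ⟨cfDigit1 x, h1, gaussMap x, ⟨by rwa [h3], h2⟩, h3⟩
    · rintro ⟨a, ha, y, ⟨hyE, hy⟩, rfl⟩
      refine ⟨hyE, (mem_badSet_iff (invBranch1_mem_gaussSet (hA a ha) hy.1)).2 ?_⟩
      rw [cfDigit1_invBranch1 hy.1, gaussMap_invBranch1 hy.1]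
      exact ⟨ha, hy⟩
  have hG : ∀ a, MeasurableSet (invBranch1 a ⁻¹' E ∩ badSet A) := fun a =>
    (measurable_invBranch1 a hE).inter hB
  rw [hdec, measure_biUnion_finset]
  · refine Finset.sum_congr rfl fun a ha => ?_
    exact hausdorffMeasure_image_invBranch1 (hA a ha) hs (hG a) fun x hx => hx.2.1.1.1
  · intro a _ b _ hab
    refine disjoint_left.2 ?_
    rintro _ ⟨y, hy, rfl⟩ ⟨z, hz, hzy⟩
    rw [← cfDigit1_invBranch1 (a := a) hy.2.1, ← hzy, cfDigit1_invBranch1 hz.2.1] at hab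
    exact hab rfl
  · intro a _
    rw [← coe_invBranchEquiv, MeasurableEquiv.measurableSet_image, coe_invBranchEquiv]
    exact hG a

/-- The normalized Hausdorff measure on `B(𝒜)` is conformal. -/
theorem isConformal_hausdorffMeasure {A : Finset ℕ} {N : ℕ} (hA : ∀ a ∈ A, 1 ≤ a ∧ a ≤ N) {s : ℝ}
    (hs : 0 ≤ s) (h0 : μH[s] (badSet A) ≠ 0) (htop : μH[s] (badSet A) ≠ ⊤) :
    IsConformal A N s ((μH[s] (badSet A))⁻¹ • (μH[s]).restrict (badSet A)) where
  prob := ⟨by simp [ENNReal.inv_mul_cancel h0 htop]⟩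
  support := by
    refine Measure.ae_smul_measure ?_ _
    filter_upwards [ae_restrict_mem (measurableSet_badSet A)] with x hx
    exact badSet_bounds hA hx
  transfer := by
    ext E hE
    have hT : ∀ a, MeasurableSet (invBranch1 a ⁻¹' E) := fun a => measurable_invBranch1 a hE
    simp only [Measure.finsetSum_apply]
    rw [Measure.smul_apply, Measure.restrict_apply hE,
      hausdorffMeasure_inter_badSet (fun a ha => (hA a ha).1) hs hE, smul_eq_mul, Finset.mul_sum]
    refine Finset.sum_congr rfl fun a _ => ?_
    rw [Measure.map_apply (measurable_invBranch1 a) hE, withDensity_apply _ (hT a),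
      Measure.restrict_smul, lintegral_smul_measure, Measure.restrict_restrict (hT a), smul_eq_mul]

/-- If at least the digits `1` and `2` are allowed, a conformal measure has exponent greater than
`1 / 2`: the function `1 / (x + 2)` is strictly increased by the transfer operator of exponent
`1 / 2`. -/
lemma IsConformal.half_lt {A : Finset ℕ} {N : ℕ} {s : ℝ} {μ : Measure ℝ}
    (hμ : IsConformal A N s μ) (hA : ∀ a ∈ A, 1 ≤ a) (h1 : 1 ∈ A) (h2 : 2 ∈ A) (hs : 0 ≤ s) :
    1 / 2 < s := by
  by_contra! hle
  have := hμ.prob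
  set f : ℝ → ℝ := fun x => (x + 2)⁻¹ with hf
  have hfm : Measurable f := by fun_prop
  have hfb : ∀ x, 0 ≤ x → 0 ≤ f x ∧ f x ≤ 1 := fun x hx =>
    ⟨by positivity, inv_le_one_of_one_le₀ (by linarith)⟩
  have hfi : Integrable f μ := by
    refine Integrable.of_bound hfm.aestronglyMeasurable 1 ?_
    filter_upwards [hμ.mem_unit] with x hx
    rw [Real.norm_eq_abs, abs_of_nonneg (hfb x hx.1).1]
    exact (hfb x hx.1).2
  set t : ℕ → ℝ → ℝ := fun a x => (x + a) ^ (-2 * s) • f (invBranch1 a x) with ht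
  have htm : ∀ a, Measurable (t a) := fun a => by
    have := measurable_invBranch1 a
    simp only [ht]
    fun_prop
  have ht0 : ∀ a ∈ A, ∀ x, 0 ≤ x → 0 ≤ t a x ∧ t a x ≤ 1 := by
    intro a ha x hx
    have ha' : (1 : ℝ) ≤ a := by exact_mod_cast hA a ha
    have h3 := hfb _ (ReversedWord.invBranch1_mem (hA a ha) hx).1
    have h4 : (x + a) ^ (-2 * s) ≤ 1 :=
      Real.rpow_le_one_of_one_le_of_nonpos (by linarith) (by linarith)
    have h5 : 0 ≤ (x + a) ^ (-2 * s) := Real.rpow_nonneg (by positivity) _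
    exact ⟨mul_nonneg h5 h3.1, mul_le_one₀ h4 h3.1 h3.2⟩
  have hti : ∀ a ∈ A, Integrable (t a) μ := by
    intro a ha
    refine Integrable.of_bound (htm a).aestronglyMeasurable 1 ?_
    filter_upwards [hμ.mem_unit] with x hx
    rw [Real.norm_eq_abs, abs_of_nonneg (ht0 a ha x hx.1).1]
    exact (ht0 a ha x hx.1).2
  have hlow : ∀ a ∈ A, ∀ x : ℝ, 0 ≤ x → (2 * (x + a) + 1)⁻¹ ≤ t a x := by
    intro a ha x hx
    have ha' : (1 : ℝ) ≤ a := by exact_mod_cast hA a ha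
    have h3 : (x + a)⁻¹ ≤ (x + a) ^ (-2 * s) := by
      rw [← Real.rpow_neg_one]
      exact Real.rpow_le_rpow_of_exponent_le (by linarith) (by linarith)
    calc (2 * (x + a) + 1)⁻¹ = (x + a)⁻¹ * ((x + a)⁻¹ + 2)⁻¹ := by
          have : 0 < x + a := by linarith
          field_simp
          ring
      _ ≤ t a x := by
          refine mul_le_mul_of_nonneg_right h3 ?_
          have : 0 < x + a := by linarith
          positivity
  have hpt : ∀ x : ℝ, 0 ≤ x → x ≤ 1 → f x + 1 / 105 ≤ t 1 x + t 2 x := by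
    intro x hx hx1
    have h3 := hlow 1 h1 x hx
    have h4 := hlow 2 h2 x hx
    push_cast at h3 h4
    have h5 : (x + 2)⁻¹ + ((2 * x + 3) * (2 * x + 5) * (x + 2))⁻¹ =
        (2 * (x + 1) + 1)⁻¹ + (2 * (x + 2) + 1)⁻¹ := by
      rw [show 2 * (x + 1) + 1 = 2 * x + 3 by ring, show 2 * (x + 2) + 1 = 2 * x + 5 by ring]
      field_simp
      ring
    have h6 : (1 : ℝ) / 105 ≤ ((2 * x + 3) * (2 * x + 5) * (x + 2))⁻¹ := by
      rw [one_div]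
      refine inv_anti₀ (by positivity) ?_
      calc (2 * x + 3) * (2 * x + 5) * (x + 2) ≤ (2 * 1 + 3) * (2 * 1 + 5) * (1 + 2) := by gcongr
        _ = 105 := by norm_num
    simp only [hf]
    linarith
  have hsum : ∫ x, t 1 x ∂μ + ∫ x, t 2 x ∂μ ≤ ∫ x, f x ∂μ := by
    rw [hμ.integral_transfer hfm.stronglyMeasurable hfi,
      ← Finset.sum_pair (f := fun a => ∫ x, t a x ∂μ) (show (1 : ℕ) ≠ 2 by norm_num)]
    refine Finset.sum_le_sum_of_subset_of_nonneg (by simp [Finset.insert_subset_iff, h1, h2])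
      fun a ha _ => integral_nonneg_of_ae ?_
    filter_upwards [hμ.mem_unit] with x hx
    exact (ht0 a ha x hx.1).1
  have hint : ∫ x, (f x + 1 / 105) ∂μ ≤ ∫ x, (t 1 x + t 2 x) ∂μ := by
    refine integral_mono_ae (hfi.add (integrable_const _)) ((hti 1 h1).add (hti 2 h2)) ?_
    filter_upwards [hμ.mem_unit] with x hx
    exact hpt x hx.1 hx.2
  rw [integral_add hfi (integrable_const _), integral_add (hti 1 h1) (hti 2 h2)] at hint
  simp only [integral_const, probReal_univ, one_smul] at hint
  linarith

lemma dimH_le_one (E : Set ℝ) : dimH E ≤ 1 := Real.dimH_univ ▸ dimH_mono (subset_univ E)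

/-- Polynomial Fourier decay of the normalized Hausdorff measure, given that its exponent exceeds
`1 / 2` whenever it is a probability measure. -/
lemma fourier_decay_of_half_lt {A : Finset ℕ} (hA : ∀ a ∈ A, 1 ≤ a) {s : ℝ} (hs0 : 0 ≤ s)
    (hs1 : s ≤ 1)
    (hs : ∀ N, IsConformal A N s ((μH[s] (badSet A))⁻¹ • (μH[s]).restrict (badSet A)) → 1 / 2 < s) :
    ∃ η > (0 : ℝ), ∃ K : ℝ, ∀ ξ : ℝ, 1 ≤ |ξ| →
      ‖muFourier ((μH[s] (badSet A))⁻¹ • (μH[s]).restrict (badSet A)) ξ‖ ≤ K * |ξ| ^ (-η) := by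
  by_cases h : μH[s] (badSet A) = 0 ∨ μH[s] (badSet A) = ⊤
  · refine ⟨1, one_pos, 0, fun ξ _ => ?_⟩
    have hzero : (μH[s] (badSet A))⁻¹ • (μH[s]).restrict (badSet A) = 0 := by
      rcases h with h | h
      · rw [Measure.restrict_eq_zero.2 h, smul_zero]
      · rw [h, ENNReal.inv_top, zero_smul]
    rw [hzero, muFourier]
    simp
  · push Not at h
    set N := A.sup id + 1 with hN
    have hAN : ∀ a ∈ A, 1 ≤ a ∧ a ≤ N := fun a ha =>
      ⟨hA a ha, (Finset.le_sup (f := id) ha).trans (Nat.le_succ _)⟩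
    have hc := isConformal_hausdorffMeasure hAN hs0 h.1 h.2
    have hhalf := hs N hc
    obtain ⟨K, hK⟩ := hc.norm_muFourier_le hAN (Nat.le_add_left _ _) hhalf hs1
    exact ⟨(s - 1 / 2) / 8, by linarith, K, hK⟩

/-- If `𝒜 ⊂ ℕ` is finite and `s = dim B(𝒜) > 1/2` then the normalized
`s`-dimensional Hausdorff measure on `B(𝒜)` has polynomially decaying Fourier
transform; in particular this holds for `B_N = B({1,…,N})` for every `N ≥ 2`. -/
theorem hausdorff_measure_badly_approximable_fourier_decay :
    (∀ A : Finset ℕ, 0 ∉ A → (1/2 : ℝ≥0∞) < dimH (badSet A) →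
      ∃ η > (0:ℝ), ∃ K : ℝ, ∀ ξ : ℝ, 1 ≤ |ξ| →
        ‖muFourier (((μH[(dimH (badSet A)).toReal] (badSet A))⁻¹ •
            (μH[(dimH (badSet A)).toReal]).restrict (badSet A))) ξ‖ ≤ K * |ξ| ^ (-η)) ∧
    (∀ N : ℕ, 2 ≤ N →
      ∃ η > (0:ℝ), ∃ K : ℝ, ∀ ξ : ℝ, 1 ≤ |ξ| →
        ‖muFourier (((μH[(dimH (badSet (Finset.Icc 1 N))).toReal] (badSet (Finset.Icc 1 N)))⁻¹ •
            (μH[(dimH (badSet (Finset.Icc 1 N))).toReal]).restrict (badSet (Finset.Icc 1 N))) ) ξ‖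
          ≤ K * |ξ| ^ (-η)) := by
  have htoReal : ∀ E : Set ℝ, (dimH E).toReal ≤ 1 := fun E =>
    ENNReal.toReal_le_of_le_ofReal zero_le_one (by simpa using dimH_le_one E)
  refine ⟨fun A hA hdim => ?_, fun N hN => ?_⟩
  · refine fourier_decay_of_half_lt
      (fun a ha => Nat.one_le_iff_ne_zero.2 fun h => hA (h ▸ ha)) ENNReal.toReal_nonneg
      (htoReal _) fun _ _ => ?_
    have := (ENNReal.toReal_lt_toReal (by simp)
      ((dimH_le_one (badSet A)).trans_lt ENNReal.one_lt_top).ne).2 hdim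
    simpa using this
  · refine fourier_decay_of_half_lt (fun a ha => (Finset.mem_Icc.1 ha).1) ENNReal.toReal_nonneg
      (htoReal _) fun M hM => ?_
    exact hM.half_lt (fun a ha => (Finset.mem_Icc.1 ha).1) (Finset.mem_Icc.2 ⟨le_rfl, by omega⟩)
      (Finset.mem_Icc.2 ⟨by omega, hN⟩) ENNReal.toReal_nonneg
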